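/- arXiv:1810.10739 — 2 statements merged into one kernel-verified Lean document; each statement's English description precedes it below -/
import Mathlib

section
/- For any domain D ⊆ ℂⁿ and any point z ∈ D, the squeezing function satisfies s_D(z) ≤ h^c_D(z), where h^c_D is the Fridman invariant with respect to the Carathéodory pseudodistance. Concretely: if f : D → 𝔹ₙ is an injective holomorphic map with f(z) = 0 and r𝔹ₙ ⊆ f(D), then the Carathéodory ball B^c_D(z, tanh⁻¹ r) is contained in f⁻¹(r𝔹ₙ), which is the injective holomorphic image of 𝔹ₙ under g(w) = f⁻¹(rw). -/
open Set Metric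

noncomputable section

/-- The inverse hyperbolic tangent. -/
def artanh (x : ℝ) : ℝ := (1 / 2) * Real.log ((1 + x) / (1 - x))

variable {n : ℕ}

/-- `ℂⁿ` as a complex Euclidean space. -/
abbrev Cn (n : ℕ) := EuclideanSpace ℂ (Fin n)

/-- The Lempert function of `D ⊆ ℂⁿ` (with values in `[0,∞]`):
`l_D(z,w) = inf { tanh⁻¹|λ| : φ : Δ → D holomorphic, φ(0) = z, φ(λ) = w }`. -/
def lempert (D : Set (Cn n)) (z w : Cn n) : ENNReal :=
  sInf {x : ENNReal | ∃ φ : ℂ → Cn n, DifferentiableOn ℂ φ (ball 0 1) ∧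
    MapsTo φ (ball 0 1) D ∧ φ 0 = z ∧
    ∃ l : ℂ, l ∈ ball (0 : ℂ) 1 ∧ φ l = w ∧ x = ENNReal.ofReal (artanh ‖l‖)}

/-- The Carathéodory pseudodistance of `D ⊆ ℂⁿ`:
`c_D(z,w) = sup { tanh⁻¹|f(w)| : f : D → Δ holomorphic, f(z) = 0 }`. -/
def cara (D : Set (Cn n)) (z w : Cn n) : ℝ :=
  sSup {x : ℝ | ∃ f : Cn n → ℂ, DifferentiableOn ℂ f D ∧ MapsTo f D (ball 0 1) ∧
    f z = 0 ∧ x = artanh ‖f w‖}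

/-- The squeezing function of `D ⊆ ℂⁿ`:
`s_D(z) = sup { r : ∃ injective holomorphic f : D → 𝔹ₙ, f(z) = 0, r𝔹ₙ ⊆ f(D) }`,
with value `0` if no such map exists. -/
def squeeze (D : Set (Cn n)) (z : Cn n) : ℝ :=
  sSup (insert (0 : ℝ) {r : ℝ | 0 < r ∧ ∃ f : Cn n → Cn n, DifferentiableOn ℂ f D ∧
    InjOn f D ∧ MapsTo f D (ball 0 1) ∧ f z = 0 ∧ ball (0 : Cn n) r ⊆ f '' D})

/-- The Fridman invariant of `D ⊆ ℂⁿ` with respect to a pseudodistance `d`: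
`h^d_D(z) = sup { tanh r : B^d_D(z,r) ⊆ g(𝔹ₙ), g : 𝔹ₙ → D injective holomorphic }`. -/
def fridman (d : Cn n → Cn n → ℝ) (D : Set (Cn n)) (z : Cn n) : ℝ :=
  sSup (insert (0 : ℝ) {x : ℝ | ∃ r : ℝ, 0 ≤ r ∧ x = Real.tanh r ∧
    ∃ g : Cn n → Cn n, DifferentiableOn ℂ g (ball 0 1) ∧ InjOn g (ball 0 1) ∧
      MapsTo g (ball 0 1) D ∧ {w ∈ D | d z w < r} ⊆ g '' ball 0 1})

/-- The Kobayashi–Royden pseudometric of `D ⊆ ℂⁿ`: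
`κ_D(z;X) = inf { |λ| : φ : Δ → D holomorphic, φ(0) = z, λ φ'(0) = X }`. -/
def kappaRoyden (D : Set (Cn n)) (z X : Cn n) : ℝ :=
  sInf {x : ℝ | ∃ φ : ℂ → Cn n, DifferentiableOn ℂ φ (ball 0 1) ∧
    MapsTo φ (ball 0 1) D ∧ φ 0 = z ∧ ∃ l : ℂ, l • fderiv ℂ φ 0 1 = X ∧ x = ‖l‖}

/-- The Kobayashi length of a curve `γ : [0,1] → D` in `D`. -/
def kobLength (D : Set (Cn n)) (γ : ℝ → Cn n) : ℝ :=
  ∫ t in (0:ℝ)..1, kappaRoyden D (γ t) (deriv γ t)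

/-- `γ` is a `C¹` curve in `D` from `z` to `w`. -/
def IsCurve (D : Set (Cn n)) (γ : ℝ → Cn n) (z w : Cn n) : Prop :=
  ContDiffOn ℝ 1 γ (Icc 0 1) ∧ MapsTo γ (Icc 0 1) D ∧ γ 0 = z ∧ γ 1 = w

/-- The Kobayashi pseudodistance of `D ⊆ ℂⁿ`, i.e. the integrated form of the
Kobayashi–Royden pseudometric. -/
def kobayashi (D : Set (Cn n)) (z w : Cn n) : ℝ :=
  sInf {L : ℝ | ∃ γ : ℝ → Cn n, IsCurve D γ z w ∧ kobLength D γ = L}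


section holo
open Filter Topology
variable {E F : Type*} [NormedAddCommGroup E] [NormedSpace ℂ E]
  [NormedAddCommGroup F] [NormedSpace ℂ F]

theorem holo_fderiv_continuousOn {U : Set E} (hU : IsOpen U) {f : E → F}
    (hf : DifferentiableOn ℂ f U) : ContinuousOn (fderiv ℂ f) U := by
  intro x hx
  apply ContinuousAt.continuousWithinAt
  have hc : ContinuousAt f x := (hf.continuousOn).continuousAt (hU.mem_nhds hx)
  have h1 : ∀ᶠ y in 𝓝 x, y ∈ U ∧ dist (f y) (f x) < 1 :=
    (hU.eventually_mem hx).and (hc.eventually (ball_mem_nhds _ one_pos) : _)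
  obtain ⟨R', hR', hb⟩ := Metric.eventually_nhds_iff_ball.1 h1
  obtain ⟨R, hR, rfl⟩ : ∃ R : ℝ, 0 < R ∧ R' = 4 * R := ⟨R' / 4, by positivity, by ring⟩
  have hlip : ∀ y ∈ ball x (2 * R), ∀ y' ∈ ball y (2 * R),
      dist (f y') (f y) ≤ 2 / (2 * R) * dist y' y := by
    intro y hy y' hy'
    have hsub : ball y (2 * R) ⊆ ball x (4 * R) := by
      apply ball_subset_ball'
      have := mem_ball.1 hy
      linarith
    refine Complex.dist_le_div_mul_dist_of_mapsTo_ball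
      (hf.mono fun a ha => (hb a (hsub ha)).1) ?_ hy'
    intro a ha
    have h2 := (hb a (hsub ha)).2
    have h3 := (hb y (hsub (mem_ball_self (by positivity)))).2
    rw [mem_closedBall]
    linarith [dist_triangle_right (f a) (f y) (f x)]
  rw [Metric.continuousAt_iff]
  intro ε hε
  refine ⟨min R (ε * R ^ 2 / 4), by positivity, ?_⟩
  intro y hy
  have hyR : dist y x < R := lt_of_lt_of_le hy (min_le_left _ _)
  have hyε : dist y x < ε * R ^ 2 / 4 := lt_of_lt_of_le hy (min_le_right _ _)
  have hbU : ∀ a ∈ ball x R, a ∈ U := fun a ha =>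
    (hb a (ball_subset_ball (by linarith) ha)).1
  have hadd : ∀ a ∈ ball x R, dist (a + (y - x)) a < R := by
    intro a ha; simpa [dist_eq_norm] using hyR
  have hbU' : ∀ a ∈ ball x R, a + (y - x) ∈ U := fun a ha => by
    refine (hb _ ?_).1
    rw [mem_ball] at ha ⊢
    linarith [dist_triangle (a + (y - x)) a x, hadd a ha]
  have hd1 : DifferentiableOn ℂ (fun a => f (a + (y - x)) - f a) (ball x R) := by
    intro a ha
    apply DifferentiableAt.differentiableWithinAt
    refine DifferentiableAt.sub ?_ (hf.differentiableAt (hU.mem_nhds (hbU a ha)))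
    exact (hf.differentiableAt (hU.mem_nhds (hbU' a ha))).comp (f := fun a => a + (y-x)) a (by fun_prop)
  have hbd : ∀ a ∈ ball x R, ‖f (a + (y - x)) - f a‖ ≤ dist y x / R := by
    intro a ha
    have h5 := hlip a (ball_subset_ball (by linarith) ha) (a + (y - x))
      (by rw [mem_ball]; linarith [hadd a ha])
    rw [← dist_eq_norm]
    refine h5.trans (le_of_eq ?_)
    rw [dist_eq_norm, dist_eq_norm]
    simp only [add_sub_cancel_left]
    field_simp
  have key := Complex.norm_fderiv_le_div_of_mapsTo_ball (R₂ := 2 * (dist y x / R)) hd1 (by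
    intro a ha
    rw [mem_closedBall, dist_eq_norm]
    refine (norm_sub_le _ _).trans ?_
    linarith [hbd a ha, hbd x (mem_ball_self hR)]) hR
  have hx2 : DifferentiableAt ℂ f (x + (y - x)) :=
    hf.differentiableAt (hU.mem_nhds (hbU' x (mem_ball_self hR)))
  have hfd : fderiv ℂ (fun a => f (a + (y - x)) - f a) x = fderiv ℂ f y - fderiv ℂ f x := by
    have hd2 : DifferentiableAt ℂ (fun a => f (a + (y - x))) x :=
      hx2.comp (f := fun a => a + (y-x)) x (by fun_prop)
    rw [fderiv_fun_sub hd2 (hf.differentiableAt (hU.mem_nhds hx)), fderiv_comp_add_right]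
    simp
  rw [hfd] at key
  rw [dist_eq_norm]
  refine key.trans_lt ?_
  rw [div_lt_iff₀ hR, ← mul_div_assoc, div_lt_iff₀ hR]
  nlinarith [dist_nonneg (x := y) (y := x), mul_pos hε (pow_pos hR 2)]

theorem holo_contDiffAt {U : Set E} (hU : IsOpen U) {f : E → F}
    (hf : DifferentiableOn ℂ f U) {x : E} (hx : x ∈ U) : ContDiffAt ℂ 1 f x := by
  have : ContDiffOn ℂ 1 f U := by
    have h0 : (1 : WithTop ℕ∞) = 0 + 1 := by simp
    rw [h0, contDiffOn_succ_iff_fderiv_of_isOpen hU, contDiffOn_zero]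
    exact ⟨hf, by simp, holo_fderiv_continuousOn hU hf⟩
  exact this.contDiffAt (hU.mem_nhds hx)

theorem holo_fderiv_apply [CompleteSpace F] {U : Set E} (hU : IsOpen U) {f : E → F}
    (hf : DifferentiableOn ℂ f U) (v : E) :
    DifferentiableOn ℂ (fun x => fderiv ℂ f x v) U := by
  intro x hx
  apply DifferentiableAt.differentiableWithinAt
  have hc := (holo_fderiv_continuousOn hU hf).continuousAt (hU.mem_nhds hx)
  have h1 : ∀ᶠ y in 𝓝 x, y ∈ U ∧ dist (fderiv ℂ f y) (fderiv ℂ f x) < 1 :=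
    (hU.eventually_mem hx).and (hc.eventually (ball_mem_nhds _ one_pos) : _)
  obtain ⟨R', hR', hb⟩ := Metric.eventually_nhds_iff_ball.1 h1
  obtain ⟨R, hR, rfl⟩ : ∃ R : ℝ, 0 < R ∧ R' = 2 * R := ⟨R' / 2, by positivity, by ring⟩
  obtain ⟨ρ, hρ, hρv⟩ : ∃ ρ : ℝ, 0 < ρ ∧ ρ * ‖v‖ < R := by
    refine ⟨R / (‖v‖ + 1), by positivity, ?_⟩
    rw [div_mul_eq_mul_div, div_lt_iff₀ (by positivity)]
    nlinarith
  have hmem : ∀ y ∈ ball x R, ∀ ζ : ℂ, ‖ζ‖ ≤ ρ → y + ζ • v ∈ ball x (2 * R) := by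
    intro y hy ζ hζ
    rw [mem_ball] at hy ⊢
    have : dist (y + ζ • v) y < R := by
      rw [dist_eq_norm, add_sub_cancel_left, norm_smul]
      exact lt_of_le_of_lt (by gcongr) hρv
    linarith [dist_triangle (y + ζ • v) y x]
  have hcm : ∀ θ, ‖circleMap 0 ρ θ‖ ≤ ρ := by
    intro θ; simp [abs_of_pos hρ]
  set k : ℝ → ℂ := fun θ => deriv (circleMap 0 ρ) θ * ((circleMap 0 ρ θ - 0) ^ 2)⁻¹ with hk
  have hkc : Continuous k := by
    simp only [hk, deriv_circleMap, sub_zero]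
    refine Continuous.mul (by fun_prop) (Continuous.inv₀ (by fun_prop) ?_)
    intro θ
    exact pow_ne_zero _ (circleMap_ne_center hρ.ne')
  have hcont : ∀ y ∈ ball x R, Continuous fun θ => f (y + circleMap 0 ρ θ • v) := by
    intro y hy
    refine hf.continuousOn.comp_continuous (by fun_prop) ?_
    intro θ
    exact (hb _ (hmem y hy _ (hcm θ))).1
  have hcont' : ∀ y ∈ ball x R, Continuous fun θ => fderiv ℂ f (y + circleMap 0 ρ θ • v) := by
    intro y hy
    refine (holo_fderiv_continuousOn hU hf).comp_continuous (by fun_prop) ?_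
    intro θ
    exact (hb _ (hmem y hy _ (hcm θ))).1
  have hform : ∀ y ∈ ball x R, fderiv ℂ f y v = (2 * Real.pi * Complex.I : ℂ)⁻¹ •
      ∫ θ in Ioc 0 (2 * Real.pi), k θ • f (y + circleMap 0 ρ θ • v) := by
    intro y hy
    have hV : IsOpen ((fun ζ : ℂ => y + ζ • v) ⁻¹' U) := hU.preimage (by fun_prop)
    have h2 := Complex.two_pi_I_inv_smul_circleIntegral_sub_sq_inv_smul_of_differentiable
      (c := 0) (w₀ := 0) (R := ρ) (f := fun ζ : ℂ => f (y + ζ • v)) hV (by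
        intro ζ hζ
        exact (hb _ (hmem y hy ζ (by simpa using hζ))).1)
        (hf.comp (by fun_prop) (fun _ h => h)) (mem_ball_self hρ)
    have h3 : deriv (fun ζ : ℂ => f (y + ζ • v)) 0 = fderiv ℂ f y v := by
      have hd : HasFDerivAt f (fderiv ℂ f y) (y + (0:ℂ) • v) := by
        simpa using (hf.differentiableAt (hU.mem_nhds (hb y (ball_subset_ball (by linarith) hy)).1)).hasFDerivAt
      have hl : HasDerivAt (fun ζ : ℂ => y + ζ • v) v 0 := by
        simpa using ((hasDerivAt_id (0:ℂ)).smul_const v).const_add y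
      exact (hd.comp_hasDerivAt 0 hl).deriv
    rw [← h3, ← h2, circleIntegral, intervalIntegral.integral_of_le (by positivity)]
    simp only [hk, mul_smul]
  have hint : HasFDerivAt (fun y => ∫ θ in Ioc 0 (2 * Real.pi), k θ • f (y + circleMap 0 ρ θ • v))
      (∫ θ in Ioc 0 (2 * Real.pi), k θ • fderiv ℂ f (x + circleMap 0 ρ θ • v)) x := by
    refine hasFDerivAt_integral_of_dominated_of_fderiv_le
      (F' := fun y θ => k θ • fderiv ℂ f (y + circleMap 0 ρ θ • v))
      (bound := fun θ => ‖k θ‖ * (1 + ‖fderiv ℂ f x‖)) (ball_mem_nhds x hR) ?_ ?_ ?_ ?_ ?_ ?_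
    · filter_upwards [ball_mem_nhds x hR] with y hy
      exact (hkc.smul (hcont y hy)).aestronglyMeasurable
    · exact (hkc.smul (hcont x (mem_ball_self hR))).integrableOn_Ioc
    · exact (hkc.smul (hcont' x (mem_ball_self hR))).aestronglyMeasurable
    · refine Eventually.of_forall fun θ y hy => ?_
      rw [norm_smul]
      gcongr
      have h4 := (hb _ (hmem y hy _ (hcm θ))).2
      rw [dist_eq_norm] at h4
      linarith [norm_le_norm_sub_add (fderiv ℂ f (y + circleMap 0 ρ θ • v)) (fderiv ℂ f x)]
    · exact (hkc.norm.mul continuous_const).integrableOn_Ioc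
    · refine Eventually.of_forall fun θ y hy => ?_
      have hd := (hf.differentiableAt (hU.mem_nhds (hb _ (hmem y hy _ (hcm θ))).1)).hasFDerivAt
      have := hd.comp y ((hasFDerivAt_id y).add_const (circleMap 0 ρ θ • v))
      exact this.const_smul (k θ)
  refine (hint.differentiableAt.const_smul ((2 * Real.pi * Complex.I : ℂ)⁻¹)).congr_of_eventuallyEq ?_
  filter_upwards [ball_mem_nhds x hR] with y hy
  exact hform y hy


theorem inj_deriv_ne_zero {U : Set ℂ} (hU : IsOpen U) {g : ℂ → ℂ}
    (hg : DifferentiableOn ℂ g U) (hinj : InjOn g U) {p : ℂ} (hp : p ∈ U) : deriv g p ≠ 0 := by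
  intro h0
  have hopen : ∀ x ∈ U, 𝓝 (g x) ≤ map g (𝓝 x) := by
    intro x hx
    rcases (hg.analyticAt (hU.mem_nhds hx)).eventually_constant_or_nhds_le_map_nhds with h | h
    · exfalso
      have h2 : ∀ᶠ y in 𝓝[≠] x, y = x := by
        filter_upwards [nhdsWithin_le_nhds h, nhdsWithin_le_nhds (hU.mem_nhds hx)] with y hy hyU
        exact hinj hyU hx hy
      obtain ⟨y, hy, hy'⟩ := (h2.and self_mem_nhdsWithin).exists
      exact hy' hy
    · exact h
  set ψ := Function.invFunOn g U with hψ
  have hleft : ∀ x ∈ U, ψ (g x) = x := fun x hx => hinj.leftInvOn_invFunOn hx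
  have hleft' : ∀ x ∈ U, ∀ᶠ y in 𝓝 x, ψ (g y) = y := fun x hx => by
    filter_upwards [hU.mem_nhds hx] with y hy using hleft y hy
  have hcont : ∀ x ∈ U, ContinuousAt ψ (g x) := by
    intro x hx
    rw [ContinuousAt, hleft x hx]
    refine Tendsto.mono_left ?_ (hopen x hx)
    rw [tendsto_map'_iff]
    exact tendsto_id.congr' ((hleft' x hx).mono fun y hy => hy.symm)
  have hdiff : ∀ x ∈ U, deriv g x ≠ 0 → DifferentiableAt ℂ ψ (g x) := by
    intro x hx hd
    have hs : HasStrictDerivAt g (deriv g x) x :=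
      (hg.analyticAt (hU.mem_nhds hx)).hasStrictDerivAt
    exact (hs.to_local_left_inverse hd (hleft' x hx)).hasDerivAt.differentiableAt
  have hψp : DifferentiableAt ℂ ψ (g p) := by
    rcases (hg.analyticAt (hU.mem_nhds hp)).deriv.eventually_eq_zero_or_eventually_ne_zero with h | h
    · exfalso
      obtain ⟨R, hR, hb⟩ := Metric.eventually_nhds_iff_ball.1 (h.and (hU.eventually_mem hp))
      have hm : p + ((R / 2 : ℝ) : ℂ) ∈ ball p R := by
        simp [abs_of_pos hR, hR]
      have := isOpen_ball.is_const_of_deriv_eq_zero (convex_ball p R).isPreconnected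
        (hg.mono fun a ha => (hb a ha).2) (fun a ha => (hb a ha).1) hm (mem_ball_self hR)
      have := hinj (hb _ hm).2 hp this
      simp [hR.ne'] at this
    · rw [eventually_nhdsWithin_iff] at h
      obtain ⟨R, hR, hb⟩ := Metric.eventually_nhds_iff_ball.1 (h.and (hU.eventually_mem hp))
      have hs : g '' ball p R ∈ 𝓝 (g p) := hopen p hp (image_mem_map (ball_mem_nhds p hR))
      have := (Complex.differentiableOn_compl_singleton_and_continuousAt_iff (f := ψ) hs).1 ⟨?_, hcont p hp⟩
      · exact this.differentiableAt hs
      · rintro _ ⟨⟨x, hx, rfl⟩, hne⟩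
        refine (hdiff x (hb x hx).2 ((hb x hx).1 ?_)).differentiableWithinAt
        rintro rfl
        exact hne rfl
  have hgd : HasDerivAt g (deriv g p) p := (hg.differentiableAt (hU.mem_nhds hp)).hasDerivAt
  have h1 := hψp.hasDerivAt.comp p hgd
  have h2 : HasDerivAt (ψ ∘ g) 1 p :=
    (hasDerivAt_id p).congr_of_eventuallyEq (hleft' p hp)
  have := h1.unique h2
  simp [h0] at this

theorem exists_smooth_vanishing {U : Set E} (hU : IsOpen U) {J : E → ℂ}
    (hJ : DifferentiableOn ℂ J U) {p : E} (hp : p ∈ U) (hJp : J p = 0)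
    (hne : ¬ ∀ᶠ x in 𝓝 p, J x = 0) :
    ∃ h : E → ℂ, DifferentiableOn ℂ h U ∧ (∀ x ∈ U, J x = 0 → h x = 0) ∧
      ∃ q ∈ U, J q = 0 ∧ fderiv ℂ h q ≠ 0 := by
  by_contra hcon
  push Not at hcon
  apply hne
  obtain ⟨R, hR, hb⟩ := Metric.eventually_nhds_iff_ball.1 (hU.eventually_mem hp)
  filter_upwards [ball_mem_nhds p hR] with y hy
  set v := y - p with hv
  let H : ℕ → E → ℂ := fun m => Nat.rec J (fun _ h x => fderiv ℂ h x v) m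
  have hH0 : H 0 = J := rfl
  have hHs : ∀ m, H (m + 1) = fun x => fderiv ℂ (H m) x v := fun m => rfl
  have hH : ∀ m, DifferentiableOn ℂ (H m) U ∧ ∀ x ∈ U, J x = 0 → H m x = 0 := by
    intro m
    induction m with
    | zero => exact ⟨hJ, fun x _ h => h⟩
    | succ m ih =>
      rw [hHs]
      refine ⟨holo_fderiv_apply hU ih.1 v, fun x hx hx0 => ?_⟩
      simp only [hcon (H m) ih.1 ih.2 x hx hx0]
      simp
  set V : Set ℂ := (fun t : ℂ => p + t • v) ⁻¹' U with hVdef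
  have hV : IsOpen V := hU.preimage (by fun_prop)
  have hit : ∀ m, ∀ t ∈ V, iteratedDeriv m (fun t : ℂ => J (p + t • v)) t = H m (p + t • v) := by
    intro m
    induction m with
    | zero => intro t _; simp [hH0]
    | succ m ih =>
      intro t ht
      rw [iteratedDeriv_succ]
      have : iteratedDeriv m (fun t : ℂ => J (p + t • v)) =ᶠ[𝓝 t] fun t => H m (p + t • v) := by
        filter_upwards [hV.mem_nhds ht] with s hs using ih s hs
      rw [this.deriv_eq]
      have hd : HasFDerivAt (H m) (fderiv ℂ (H m) (p + t • v)) (p + t • v) :=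
        ((hH m).1.differentiableAt (hU.mem_nhds ht)).hasFDerivAt
      have hl : HasDerivAt (fun ζ : ℂ => p + ζ • v) v t := by
        simpa using ((hasDerivAt_id t).smul_const v).const_add p
      exact (hd.comp_hasDerivAt t hl).deriv
  obtain ⟨r, hr1, hr⟩ : ∃ r : ℝ, 1 < r ∧ r * ‖v‖ < R := by
    have hvR : ‖v‖ < R := by simpa [hv, dist_eq_norm] using hy
    rcases (norm_nonneg v).eq_or_lt with h | h
    · exact ⟨2, by norm_num, by rw [← h]; simpa using hR⟩
    · obtain ⟨r, h1, h2⟩ := exists_between ((one_lt_div h).2 hvR)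
      exact ⟨r, h1, (lt_div_iff₀ h).1 h2⟩
  have hsub : ball (0:ℂ) r ⊆ V := by
    intro t ht
    refine hb _ ?_
    rw [mem_ball, dist_eq_norm, add_sub_cancel_left, norm_smul]
    refine lt_of_le_of_lt ?_ hr
    gcongr
    simpa using (mem_ball.1 ht).le
  have hdφ : DifferentiableOn ℂ (fun t : ℂ => J (p + t • v)) (ball 0 r) :=
    (hJ.comp (by fun_prop) (fun _ h => h) : DifferentiableOn ℂ (fun t : ℂ => J (p + t • v)) V).mono hsub
  have hsum := Complex.hasSum_taylorSeries_on_ball (z := 1) hdφ (by simpa using hr1)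
  have hz : ∀ m, iteratedDeriv m (fun t : ℂ => J (p + t • v)) 0 = 0 := by
    intro m
    rw [hit m 0 (hsub (mem_ball_self (by linarith)))]
    simpa using (hH m).2 p hp hJp
  simp only [hz, smul_zero] at hsum
  have := hsum.unique hasSum_zero
  simpa [hv] using this

theorem min_mod {u : ℂ → ℂ} {ε c : ℝ} (hε : 0 < ε) (hc : 0 < c)
    (hu : DifferentiableOn ℂ u (closedBall 0 ε)) (hne : ∀ t ∈ closedBall (0:ℂ) ε, u t ≠ 0)
    (hb : ∀ t ∈ sphere (0:ℂ) ε, c ≤ ‖u t‖) : c ≤ ‖u 0‖ := by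
  have hd : DiffContOnCl ℂ (fun t => (u t)⁻¹) (ball 0 ε) := by
    apply DifferentiableOn.diffContOnCl
    rw [closure_ball _ hε.ne']
    exact hu.inv hne
  have := Complex.norm_le_of_forall_mem_frontier_norm_le isBounded_ball hd (C := c⁻¹) (by
    rw [frontier_ball _ hε.ne']
    intro t ht
    rw [norm_inv]
    exact inv_anti₀ hc (hb t ht)) (subset_closure (mem_ball_self hε))
  rw [norm_inv] at this
  exact (inv_le_inv₀ (norm_pos_iff.2 (hne 0 (by simp [hε.le]))) hc).1 this

theorem straighten [CompleteSpace E] {U : Set E} (hU : IsOpen U) {h : E → ℂ}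
    (hh : DifferentiableOn ℂ h U) {q : E} (hq : q ∈ U) {e : E} (he : fderiv ℂ h q e = 1) :
    ∃ (Ψ : E → E) (y₀ : E) (R : ℝ), 0 < R ∧ DifferentiableOn ℂ Ψ (ball y₀ R) ∧
      MapsTo Ψ (ball y₀ R) U ∧ InjOn Ψ (ball y₀ R) ∧ Ψ y₀ = q ∧
      (∀ y ∈ ball y₀ R, fderiv ℂ h q y = h (Ψ y)) ∧
      HasFDerivAt Ψ (ContinuousLinearMap.id ℂ E) y₀ := by
  set l := fderiv ℂ h q with hl
  set Φ : E → E := fun x => x + (h x - l x) • e with hΦ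
  have hΦd : DifferentiableOn ℂ Φ U := by
    intro x hx
    have := hh x hx
    simp only [hΦ]
    fun_prop
  have hΦ' : HasFDerivAt Φ ((ContinuousLinearEquiv.refl ℂ E : E ≃L[ℂ] E) : E →L[ℂ] E) q := by
    have h1 : HasFDerivAt h l q := (hh.differentiableAt (hU.mem_nhds hq)).hasFDerivAt
    have h2 := (hasFDerivAt_id (𝕜 := ℂ) q).add ((h1.sub l.hasFDerivAt).smul_const e)
    refine h2.congr_fderiv ?_
    ext x
    simp
  have hC : ContDiffAt ℂ 1 Φ q := holo_contDiffAt hU hΦd hq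
  set T := hC.toOpenPartialHomeomorph Φ hΦ' one_ne_zero with hT
  have hTt : Φ q ∈ T.target := hC.image_mem_toOpenPartialHomeomorph_target hΦ' one_ne_zero
  have hinv : ContDiffAt ℂ 1 T.symm (Φ q) := hC.to_localInverse hΦ' one_ne_zero
  have hq0 : T.symm (Φ q) = q := hC.localInverse_apply_image hΦ' one_ne_zero
  have e1 : ∀ᶠ y in 𝓝 (Φ q), DifferentiableAt ℂ T.symm y :=
    (hinv.eventually (by simp)).mono fun y hy => hy.differentiableAt one_ne_zero
  have e2 : ∀ᶠ y in 𝓝 (Φ q), T.symm y ∈ U := by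
    apply hinv.continuousAt.eventually_mem
    rw [hq0]; exact hU.mem_nhds hq
  obtain ⟨R, hR, hb⟩ := Metric.eventually_nhds_iff_ball.1
    (e1.and (e2.and (T.open_target.eventually_mem hTt)))
  refine ⟨T.symm, Φ q, R, hR, fun y hy => (hb y hy).1.differentiableWithinAt,
    fun y hy => (hb y hy).2.1, ?_, hq0, ?_, ?_⟩
  · exact T.symm.injOn.mono fun y hy => (hb y hy).2.2
  · intro y hy
    have h3 : Φ (T.symm y) = y := T.right_inv (hb y hy).2.2
    conv_lhs => rw [← h3]
    simp [hΦ, he]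
  · exact ((hC.hasStrictFDerivAt' hΦ' one_ne_zero).to_localInverse).hasFDerivAt

theorem diffOn_prod {ι : Type*} (s : Finset ι) {g : ι → E → ℂ} {U : Set E}
    (hg : ∀ i, DifferentiableOn ℂ (g i) U) : DifferentiableOn ℂ (fun x => ∏ i ∈ s, g i x) U := by
  classical
  induction s using Finset.induction_on with
  | empty => simp
  | insert a s ha ih =>
    simp only [Finset.prod_insert ha]
    exact (hg a).mul ih

theorem osgood_step2 [FiniteDimensional ℂ E] [FiniteDimensional ℂ F]
    (hE : 2 ≤ Module.finrank ℂ E) (hEF : Module.finrank ℂ F = Module.finrank ℂ E)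
    {U : Set E} (hU : IsOpen U) {f : E → F} (hf : DifferentiableOn ℂ f U) (hinj : InjOn f U)
    (hrank : ∀ x ∈ U, ¬ Function.Injective (fderiv ℂ f x) → fderiv ℂ f x = 0)
    {p : E} (hp : p ∈ U) : Function.Injective (fderiv ℂ f p) := by
  by_contra hpn
  have : CompleteSpace E := FiniteDimensional.complete ℂ E
  have : CompleteSpace F := FiniteDimensional.complete ℂ F
  have : Nontrivial E := Module.nontrivial_of_finrank_pos (R := ℂ) (by omega)
  have : Nonempty (Fin (Module.finrank ℂ E)) := ⟨⟨0, by omega⟩⟩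
  let b := Module.finBasis ℂ E
  let c := Module.finBasisOfFinrankEq ℂ F hEF
  let J : E → ℂ := fun x => (LinearMap.toMatrix b c (fderiv ℂ f x : E →ₗ[ℂ] F)).det
  have hJd : DifferentiableOn ℂ J U := by
    have hent : ∀ i j, DifferentiableOn ℂ (fun x => c.repr (fderiv ℂ f x (b j)) i) U := by
      intro i j
      exact ((c.coord i).toContinuousLinearMap.differentiable.comp_differentiableOn
        (holo_fderiv_apply hU hf (b j)))
    simp only [J, Matrix.det_apply, LinearMap.toMatrix_apply]
    refine DifferentiableOn.fun_sum fun σ _ => ?_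
    refine DifferentiableOn.fun_const_smul ?_ _
    exact diffOn_prod _ fun i => hent _ _
  have hJ0 : ∀ x ∈ U, J x = 0 → fderiv ℂ f x = 0 := by
    intro x hx h0
    apply hrank x hx
    intro hi
    obtain ⟨v, hv, hv0⟩ := Matrix.exists_mulVec_eq_zero_iff.2 h0
    apply hv
    have h1 := LinearMap.toMatrix_mulVec_repr b c (fderiv ℂ f x : E →ₗ[ℂ] F) (b.equivFun.symm v)
    have h2 : ⇑(b.repr (b.equivFun.symm v)) = v := by
      rw [← b.equivFun_apply, LinearEquiv.apply_symm_apply]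
    rw [h2, hv0] at h1
    have h3 : fderiv ℂ f x (b.equivFun.symm v) = 0 := by
      apply c.repr.injective
      ext i
      simpa using (congrFun h1 i).symm
    have h4 : b.equivFun.symm v = 0 := hi (by simpa using h3)
    exact (LinearEquiv.map_eq_zero_iff _).1 h4
  have hJp : J p = 0 := by
    simp only [J, hrank p hp hpn]
    simp [Matrix.det_zero]
  obtain ⟨w₀, hw₀⟩ := exists_ne (0 : E)
  by_cases hev : ∀ᶠ x in 𝓝 p, J x = 0
  · obtain ⟨R, hR, hb⟩ := Metric.eventually_nhds_iff_ball.1 (hev.and (hU.eventually_mem hp))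
    have hconst : ∀ y ∈ ball p R, y = p := by
      intro y hy
      refine hinj (hb y hy).2 hp ?_
      exact isOpen_ball.is_const_of_fderiv_eq_zero (𝕜 := ℂ) (convex_ball p R).isPreconnected
        (hf.mono fun a ha => (hb a ha).2) (fun a ha => hJ0 a (hb a ha).2 (hb a ha).1) hy
        (mem_ball_self hR)
    have h5 := hconst (p + ((R / 2 / ‖w₀‖ : ℝ) : ℂ) • w₀) (by
      rw [mem_ball, dist_eq_norm, add_sub_cancel_left, norm_smul, Complex.norm_real,
        Real.norm_of_nonneg (by positivity), div_mul_cancel₀ _ (norm_ne_zero_iff.2 hw₀)]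
      linarith)
    simp [hR.ne', hw₀] at h5
  obtain ⟨h, hhd, hhJ, q, hq, hJq, hdq⟩ := exists_smooth_vanishing hU hJd hp hJp hev
  obtain ⟨e, he⟩ : ∃ e, fderiv ℂ h q e = 1 := by
    obtain ⟨e, he⟩ : ∃ e, fderiv ℂ h q e ≠ 0 := by
      by_contra hh
      push Not at hh
      exact hdq (ContinuousLinearMap.ext hh)
    exact ⟨(fderiv ℂ h q e)⁻¹ • e, by simp [he]⟩
  obtain ⟨Ψ, y₀, R, hR, hΨd, hΨU, hΨinj, hΨ0, hΨl, -⟩ := straighten hU hhd hq he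
  set l := fderiv ℂ h q with hl
  have hy0 : y₀ ∈ ball y₀ R := mem_ball_self hR
  have hly0 : l y₀ = 0 := by
    rw [hΨl y₀ hy0, hΨ0]; exact hhJ q hq hJq
  set Q : E → ℂ := fun y => J (Ψ y) with hQ
  have hQd : DifferentiableOn ℂ Q (ball y₀ R) := hJd.comp hΨd hΨU
  have hQl : ∀ y ∈ ball y₀ R, Q y = 0 → l y = 0 := by
    intro y hy h0
    rw [hΨl y hy]; exact hhJ _ (hΨU hy) h0
  obtain ⟨ε, hε, hεe⟩ : ∃ ε : ℝ, 0 < ε ∧ ε * ‖e‖ < R / 2 := by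
    refine ⟨R / 2 / (‖e‖ + 1), by positivity, ?_⟩
    rw [div_mul_eq_mul_div, div_lt_iff₀ (by positivity)]
    nlinarith
  have hmem : ∀ k : E, ‖k‖ < R / 2 → ∀ s : ℂ, ‖s‖ ≤ ε → y₀ + k + s • e ∈ ball y₀ R := by
    intro k hk s hs
    rw [mem_ball, dist_eq_norm, add_assoc, add_sub_cancel_left]
    refine (norm_add_le _ _).trans_lt ?_
    rw [norm_smul]
    have : ‖s‖ * ‖e‖ ≤ ε * ‖e‖ := by gcongr
    linarith
  have hQs : ∀ s ∈ sphere (0:ℂ) ε, Q (y₀ + 0 + s • e) ≠ 0 := by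
    intro s hs h0
    have hs' : ‖s‖ = ε := by simpa using hs
    have := hQl _ (hmem 0 (by simpa using hR) s hs'.le) h0
    simp [hly0, he] at this
    rw [this] at hs'
    simp at hs'
    linarith
  have hQc : ∀ k : E, ‖k‖ < R / 2 → ∀ s : ℂ, ‖s‖ ≤ ε →
      ContinuousAt (fun x : E × ℂ => ‖Q (y₀ + x.1 + x.2 • e)‖) (k, s) := by
    intro k hk s hs
    apply ContinuousAt.norm
    refine ContinuousAt.comp (f := fun x : E × ℂ => y₀ + x.1 + x.2 • e) (g := Q) ?_ (by fun_prop)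
    exact hQd.continuousOn.continuousAt (isOpen_ball.mem_nhds (hmem k hk s hs))
  obtain ⟨s₀, hs₀, hmin⟩ := (isCompact_sphere (0:ℂ) ε).exists_isMinOn
    (NormedSpace.sphere_nonempty.2 hε.le) (f := fun s => ‖Q (y₀ + 0 + s • e)‖) (by
      intro s hs
      have hs' : ‖s‖ = ε := by simpa using hs
      have := (hQc 0 (by simpa using hR) s hs'.le).comp (f := fun s : ℂ => ((0:E), s)) (x := s)
        (by fun_prop)
      exact this.continuousWithinAt)
  obtain ⟨cc, hcc, hccl⟩ := exists_between (norm_pos_iff.2 (hQs s₀ hs₀))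
  have ev1 : ∀ᶠ k : E in 𝓝 0, ∀ s ∈ sphere (0:ℂ) ε, cc < ‖Q (y₀ + k + s • e)‖ := by
    apply (isCompact_sphere (0:ℂ) ε).eventually_forall_of_forall_eventually
    intro s hs
    have hs' : ‖s‖ = ε := by simpa using hs
    apply (hQc 0 (by simpa using hR) s hs'.le).eventually_const_lt
    exact hccl.trans_le (hmin hs)
  have ev2 : ∀ᶠ k : E in 𝓝 0, ‖Q (y₀ + k + (0:ℂ) • e)‖ < cc := by
    have hcq := (hQc 0 (by simpa using hR) 0 (by simpa using hε.le)).comp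
      (f := fun k : E => (k, (0:ℂ))) (x := (0:E)) (by fun_prop)
    refine hcq.eventually_lt_const ?_
    simpa [hQ, hΨ0, hJq] using hcc
  obtain ⟨δ, hδ, hδb⟩ := Metric.eventually_nhds_iff_ball.1
    (ev1.and (ev2.and (ball_mem_nhds (0:E) (half_pos hR))))
  have hzero : ∀ k ∈ ball (0:E) δ, l k = 0 → y₀ + k ∈ ball y₀ R ∧ Q (y₀ + k) = 0 := by
    intro k hk hlk
    obtain ⟨h1, h2, h3⟩ := hδb k hk
    have h3' : ‖k‖ < R / 2 := by simpa using h3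
    refine ⟨by simpa using hmem k h3' 0 (by simpa using hε.le), ?_⟩
    by_contra hne
    have := min_mod (u := fun s => Q (y₀ + k + s • e)) hε hcc (by
      refine hQd.comp (by fun_prop) ?_
      intro s hs
      exact hmem k h3' s (by simpa using hs)) (by
      intro s hs h0
      have h4 := hQl _ (hmem k h3' s (by simpa using hs)) h0
      simp [hly0, hlk, he] at h4
      rw [h4] at h0
      apply hne
      simpa using h0) (fun s hs => (h1 s hs).le)
    exact absurd h2 (not_lt.2 this)
  obtain ⟨v, hv0, hv⟩ : ∃ v : E, v ≠ 0 ∧ l v = 0 := by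
    have hker : LinearMap.ker (l : E →ₗ[ℂ] ℂ) ≠ ⊥ := by
      apply LinearMap.ker_ne_bot_of_finrank_lt
      rw [Module.finrank_self]; omega
    obtain ⟨v, hv, hv0⟩ := Submodule.exists_mem_ne_zero_of_ne_bot hker
    exact ⟨v, hv0, by simpa using hv⟩
  have hvpos : 0 < ‖v‖ := norm_pos_iff.2 hv0
  have hline : ∀ t ∈ ball (0:ℂ) (δ / ‖v‖), t • v ∈ ball (0:E) δ := by
    intro t ht
    rw [mem_ball_zero_iff] at ht ⊢
    rw [norm_smul]
    exact (lt_div_iff₀ hvpos).1 ht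
  have hder : ∀ t ∈ ball (0:ℂ) (δ / ‖v‖), HasDerivAt (fun t : ℂ => f (Ψ (y₀ + t • v))) 0 t := by
    intro t ht
    obtain ⟨h1, h2⟩ := hzero (t • v) (hline t ht) (by simp [hv])
    have hfz : fderiv ℂ f (Ψ (y₀ + t • v)) = 0 := hJ0 _ (hΨU h1) h2
    have d1 : HasFDerivAt f (0 : E →L[ℂ] F) (Ψ (y₀ + t • v)) := by
      rw [← hfz]
      exact (hf.differentiableAt (hU.mem_nhds (hΨU h1))).hasFDerivAt
    have d2 := (hΨd.differentiableAt (isOpen_ball.mem_nhds h1)).hasFDerivAt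
    have d3 : HasDerivAt (fun ζ : ℂ => y₀ + ζ • v) v t := by
      simpa using ((hasDerivAt_id t).smul_const v).const_add y₀
    have d4 := d1.comp_hasDerivAt t (d2.comp_hasDerivAt t d3)
    rw [zero_apply] at d4
    exact d4
  have ht0 : ((δ / ‖v‖ / 2 : ℝ) : ℂ) ∈ ball (0:ℂ) (δ / ‖v‖) := by
    rw [mem_ball_zero_iff, Complex.norm_real, Real.norm_of_nonneg (by positivity)]
    have : 0 < δ / ‖v‖ := by positivity
    linarith
  have h00 : (0:ℂ) ∈ ball (0:ℂ) (δ / ‖v‖) := mem_ball_self (by positivity)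
  have heq := isOpen_ball.is_const_of_deriv_eq_zero (convex_ball (0:ℂ) (δ / ‖v‖)).isPreconnected
    (fun t ht => (hder t ht).differentiableAt.differentiableWithinAt)
    (fun t ht => (hder t ht).deriv) ht0 h00
  have m1 := (hzero _ (hline _ ht0) (by simp [hv])).1
  have m2 := (hzero _ (hline _ h00) (by simp)).1
  have := hΨinj m1 m2 (hinj (hΨU m1) (hΨU m2) heq)
  simp [hv0, hδ.ne'] at this

theorem osgood (d : ℕ) : ∀ (E F : Type) [NormedAddCommGroup E] [NormedSpace ℂ E]
    [NormedAddCommGroup F] [NormedSpace ℂ F] [FiniteDimensional ℂ E] [FiniteDimensional ℂ F],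
    Module.finrank ℂ E = d → Module.finrank ℂ F = d →
    ∀ (U : Set E), IsOpen U → ∀ f : E → F, DifferentiableOn ℂ f U → InjOn f U →
    ∀ p ∈ U, Function.Injective (fderiv ℂ f p) := by
  induction d with
  | zero =>
    intro E F _ _ _ _ _ _ hE hF U hU f hf hinj p hp
    have := Module.finrank_zero_iff.1 hE
    exact Function.injective_of_subsingleton _
  | succ d IH =>
    intro E F _ _ _ _ _ _ hE hF U hU f hf hinj
    have : CompleteSpace E := FiniteDimensional.complete ℂ E
    have : CompleteSpace F := FiniteDimensional.complete ℂ F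
    have step1 : ∀ p ∈ U, fderiv ℂ f p ≠ 0 → Function.Injective (fderiv ℂ f p) := by
      intro p hp hA
      set A := fderiv ℂ f p with hAdef
      have hfA : HasFDerivAt f A p := (hf.differentiableAt (hU.mem_nhds hp)).hasFDerivAt
      obtain ⟨e, he⟩ : ∃ e, A e ≠ 0 := by
        by_contra hh
        push Not at hh
        exact hA (ContinuousLinearMap.ext hh)
      obtain ⟨m, hm⟩ := SeparatingDual.exists_eq_one (R := ℂ) he
      have hhd : DifferentiableOn ℂ (fun x => m (f x)) U :=
        m.differentiable.comp_differentiableOn hf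
      have hh' : fderiv ℂ (fun x => m (f x)) p = m.comp A :=
        (m.hasFDerivAt.comp p hfA).fderiv
      obtain ⟨Ψ, y₀, R, hR, hΨd, hΨU, hΨinj, hΨ0, hΨl, hΨ'⟩ :=
        straighten hU hhd hp (e := e) (by rw [hh']; simpa using hm)
      rw [hh'] at hΨl
      let K : Submodule ℂ E := LinearMap.ker ((m.comp A : E →L[ℂ] ℂ) : E →ₗ[ℂ] ℂ)
      let N : Submodule ℂ F := LinearMap.ker (m : F →ₗ[ℂ] ℂ)
      have hK : Module.finrank ℂ K = d := by
        have := Module.Dual.finrank_ker_add_one_of_ne_zero (f := ((m.comp A : E →L[ℂ] ℂ) : E →ₗ[ℂ] ℂ))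
          (fun h0 => by simpa [hm] using LinearMap.congr_fun h0 e)
        simp only [K]; omega
      have hN : Module.finrank ℂ N = d := by
        have := Module.Dual.finrank_ker_add_one_of_ne_zero (f := (m : F →ₗ[ℂ] ℂ))
          (fun h0 => by simpa [hm] using LinearMap.congr_fun h0 (A e))
        simp only [N]; omega
      let P : F →L[ℂ] N := (ContinuousLinearMap.id ℂ F - m.smulRight (A e)).codRestrict N (by
        intro w; simp [N, hm])
      have hP : ∀ w, (P w : F) = w - m w • A e := fun w => rfl
      let G : K → N := fun k => P (f (Ψ (y₀ + k)))
      have hmemK : ∀ k ∈ ball (0:K) R, y₀ + (k : E) ∈ ball y₀ R := by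
        intro k hk
        simpa [dist_eq_norm] using hk
      have hGd : DifferentiableOn ℂ G (ball 0 R) := by
        refine P.differentiable.comp_differentiableOn ?_
        refine hf.comp (hΨd.comp (f := fun k : K => y₀ + (k : E)) ?_ hmemK) (hΨU.comp hmemK)
        exact (K.subtypeL.differentiable.const_add y₀).differentiableOn
      have hGm : ∀ k ∈ ball (0:K) R, m (f (Ψ (y₀ + k))) = m (A y₀) := by
        intro k hk
        rw [← hΨl _ (hmemK k hk)]
        have : m (A k) = 0 := k.2
        simp [this]
      have hGi : InjOn G (ball 0 R) := by
        intro k hk k' hk' hkk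
        have h1 : (G k : F) = G k' := by rw [hkk]
        simp only [G, hP, hGm k hk, hGm k' hk'] at h1
        have h2 := hinj (hΨU (hmemK k hk)) (hΨU (hmemK k' hk')) (sub_left_injective h1)
        have h3 := hΨinj (hmemK k hk) (hmemK k' hk') h2
        exact Subtype.ext (add_left_cancel h3)
      have hI := IH K N hK hN (ball 0 R) isOpen_ball G hGd hGi 0 (mem_ball_self hR)
      have hG' : HasFDerivAt G (P.comp (A.comp K.subtypeL)) 0 := by
        have d3 : HasFDerivAt (fun k : K => y₀ + (k : E)) K.subtypeL 0 :=
          (K.subtypeL.hasFDerivAt).const_add y₀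
        have d2 : HasFDerivAt Ψ (ContinuousLinearMap.id ℂ E) (y₀ + ((0:K) : E)) := by
          simpa using hΨ'
        have d1 : HasFDerivAt f A (Ψ (y₀ + ((0:K) : E))) := by
          simpa [hΨ0] using hfA
        have d4 := P.hasFDerivAt.comp (0:K) (d1.comp (0:K) (d2.comp (0:K) d3))
        exact d4
      rw [hG'.fderiv] at hI
      rw [injective_iff_map_eq_zero]
      intro v hv
      have hvK : v ∈ K := by simp [K, hv]
      have : (⟨v, hvK⟩ : K) = 0 := by
        apply hI
        simp [hv]
      simpa using congrArg Subtype.val this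
    rcases Nat.eq_zero_or_pos d with rfl | hd
    · intro p hp
      apply step1 p hp
      intro h0
      have : Nontrivial E := Module.nontrivial_of_finrank_pos (R := ℂ) (by omega)
      obtain ⟨e, he⟩ := exists_ne (0 : E)
      have hFC : Module.finrank ℂ F = Module.finrank ℂ ℂ := by rw [hF, Module.finrank_self]
      let L : F ≃L[ℂ] ℂ := ContinuousLinearEquiv.ofFinrankEq hFC
      have hV : IsOpen ((fun t : ℂ => p + t • e) ⁻¹' U) := hU.preimage (by fun_prop)
      refine inj_deriv_ne_zero hV (g := fun t : ℂ => L (f (p + t • e))) (p := 0) ?_ ?_ ?_ ?_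
      · exact L.differentiable.comp_differentiableOn (hf.comp (by fun_prop) (fun _ h => h))
      · intro t ht t' ht' htt
        have := add_left_cancel (hinj ht ht' (L.injective htt))
        exact smul_left_injective ℂ he this
      · simpa using hp
      · have d1 : HasFDerivAt f (0 : E →L[ℂ] F) (p + (0:ℂ) • e) := by
          rw [← h0]
          simpa using (hf.differentiableAt (hU.mem_nhds hp)).hasFDerivAt
        have d3 : HasDerivAt (fun ζ : ℂ => p + ζ • e) e 0 := by
          simpa using ((hasDerivAt_id (0:ℂ)).smul_const e).const_add p
        have := (L.hasFDerivAt.comp_hasDerivAt (0:ℂ) (d1.comp_hasDerivAt (0:ℂ) d3)).deriv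
        rw [zero_apply, map_zero] at this
        exact this
    · intro p hp
      refine osgood_step2 (by omega) (by omega) hU hf hinj (fun x hx hn => ?_) hp
      by_contra h
      exact hn (step1 x hx h)

theorem inverse_holo {n : ℕ} {D : Set (EuclideanSpace ℂ (Fin n))} (hD : IsOpen D)
    {f : EuclideanSpace ℂ (Fin n) → EuclideanSpace ℂ (Fin n)}
    (hf : DifferentiableOn ℂ f D) (hinj : InjOn f D) {x : EuclideanSpace ℂ (Fin n)}
    (hx : x ∈ D) : DifferentiableAt ℂ (Function.invFunOn f D) (f x) := by
  have hI := osgood n _ _ (by simp) (by simp) D hD f hf hinj x hx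
  let L := (LinearEquiv.ofInjectiveEndo (fderiv ℂ f x).toLinearMap hI).toContinuousLinearEquiv
  have hL : (L : EuclideanSpace ℂ (Fin n) →L[ℂ] EuclideanSpace ℂ (Fin n)) = fderiv ℂ f x := by
    ext v : 1
    rfl
  have hs : HasStrictFDerivAt f (L : EuclideanSpace ℂ (Fin n) →L[ℂ] EuclideanSpace ℂ (Fin n)) x := by
    rw [hL]
    exact (holo_contDiffAt hD hf hx).hasStrictFDerivAt one_ne_zero
  refine (hs.to_local_left_inverse ?_).hasFDerivAt.differentiableAt
  filter_upwards [hD.mem_nhds hx] with y hy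
  exact hinj.leftInvOn_invFunOn hy

theorem normSq_pick (a ζ : ℂ) : ‖1 - (starRingEnd ℂ) a * ζ‖ ^ 2 =
    ‖ζ - a‖ ^ 2 + (1 - ‖a‖ ^ 2) * (1 - ‖ζ‖ ^ 2) := by
  simp only [Complex.sq_norm, Complex.normSq_apply]
  simp
  ring

theorem pick_bound {x y : E} {R : ℝ} {f : E → ℂ} (hf : DifferentiableOn ℂ f (ball x R))
    (hm : MapsTo f (ball x R) (ball 0 1)) (hR : 0 < R) (hy : dist y x < R / 2) :
    3 / 16 * (1 - ‖f x‖) ≤ 1 - ‖f y‖ := by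
  have hx : x ∈ ball x R := mem_ball_self hR
  have hyR : y ∈ ball x R := by rw [mem_ball]; linarith
  have hn : ∀ w ∈ ball x R, ‖f w‖ < 1 := fun w hw => by simpa using hm hw
  set a := f x with ha
  have ha1 : ‖a‖ < 1 := hn x hx
  have hden : ∀ w ∈ ball x R, 1 - ‖a‖ ≤ ‖1 - (starRingEnd ℂ) a * f w‖ := by
    intro w hw
    have h1 := norm_sub_norm_le (1 : ℂ) ((starRingEnd ℂ) a * f w)
    rw [norm_mul, RCLike.norm_conj, norm_one] at h1
    have := hn w hw
    nlinarith [norm_nonneg a, norm_nonneg (f w)]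
  have hden0 : ∀ w ∈ ball x R, 0 < ‖1 - (starRingEnd ℂ) a * f w‖ := fun w hw => by
    linarith [hden w hw]
  have hS := Complex.dist_le_div_mul_dist_of_mapsTo_ball (R₂ := 1)
    (f := fun w => (f w - a) / (1 - (starRingEnd ℂ) a * f w)) (c := x) (z := y) (R₁ := R) (by
      intro w hw
      have := hf w hw
      have h0 := norm_pos_iff.1 (hden0 w hw)
      fun_prop (disch := assumption)) (by
      intro w hw
      simp only [← ha, sub_self, zero_div, mem_closedBall_zero_iff, norm_div]
      rw [div_le_one (hden0 w hw)]
      apply le_of_sq_le_sq _ (norm_nonneg _)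
      rw [normSq_pick]
      have := hn w hw
      have : 0 ≤ (1 - ‖a‖ ^ 2) * (1 - ‖f w‖ ^ 2) := by
        apply mul_nonneg <;> nlinarith [norm_nonneg a, norm_nonneg (f w)]
      linarith) hyR
  simp only [← ha, sub_self, zero_div, dist_zero_right, norm_div] at hS
  have h2 : ‖f y - a‖ / ‖1 - (starRingEnd ℂ) a * f y‖ ≤ 1 / 2 := by
    refine hS.trans ?_
    rw [one_div, inv_mul_le_iff₀ hR]
    linarith
  rw [div_le_iff₀ (hden0 y hyR)] at h2
  have h3 := normSq_pick a (f y)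
  have h4 := hden y hyR
  have h5 := hn y hyR
  have hd := hden0 y hyR
  set d := ‖1 - (starRingEnd ℂ) a * f y‖
  have h6 : ‖f y - a‖ ^ 2 ≤ d ^ 2 / 4 := by
    nlinarith [norm_nonneg (f y - a)]
  have h7 : (1 - ‖a‖) ^ 2 ≤ d ^ 2 := by
    apply pow_le_pow_left₀ (by linarith) h4
  have h8 : 3 / 4 * (1 - ‖a‖) ^ 2 ≤ (1 - ‖a‖) * ((1 + ‖a‖) * (1 - ‖f y‖ ^ 2)) := by nlinarith
  have h9 : 3 / 4 * (1 - ‖a‖) ≤ (1 + ‖a‖) * (1 - ‖f y‖ ^ 2) := by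
    have hp : 0 < 1 - ‖a‖ := by linarith
    refine le_of_mul_le_mul_left ?_ hp
    linarith
  have h10 : 0 ≤ 1 - ‖f y‖ := by linarith
  have h11 : (1 + ‖a‖) * (1 - ‖f y‖ ^ 2) ≤ 4 * (1 - ‖f y‖) := by
    have : (1 + ‖a‖) * (1 + ‖f y‖) ≤ 4 := by nlinarith [norm_nonneg a, norm_nonneg (f y)]
    nlinarith
  linarith

theorem cara_finite {D : Set E} (hD : IsOpen D) (hc : IsPreconnected D) {z w : E}
    (hz : z ∈ D) (hw : w ∈ D) : ∃ c : ℝ, 0 < c ∧ ∀ f : E → ℂ, DifferentiableOn ℂ f D →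
      MapsTo f D (ball 0 1) → c * (1 - ‖f z‖) ≤ 1 - ‖f w‖ := by
  refine hc.induction₂' (fun z w => ∃ c : ℝ, 0 < c ∧ ∀ f : E → ℂ, DifferentiableOn ℂ f D →
      MapsTo f D (ball 0 1) → c * (1 - ‖f z‖) ≤ 1 - ‖f w‖) ?_ ?_ hz hw
  · intro x hx
    obtain ⟨R, hR, hb⟩ := Metric.eventually_nhds_iff_ball.1 (hD.eventually_mem hx)
    apply nhdsWithin_le_nhds
    filter_upwards [ball_mem_nhds x (show 0 < R / 4 by positivity)] with y hy
    rw [mem_ball] at hy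
    have hsub : ball y (R / 2) ⊆ ball x R := ball_subset_ball' (by linarith)
    constructor
    · refine ⟨3 / 16, by norm_num, fun f hf hm => ?_⟩
      exact pick_bound (hf.mono hb) (hm.mono_left hb) hR (by linarith)
    · refine ⟨3 / 16, by norm_num, fun f hf hm => ?_⟩
      exact pick_bound (hf.mono (hsub.trans hb)) (hm.mono_left (hsub.trans hb))
        (half_pos hR) (by rw [dist_comm]; linarith)
  · rintro x y u - - - ⟨c, hc, h⟩ ⟨c', hc', h'⟩
    refine ⟨c' * c, by positivity, fun f hf hm => ?_⟩
    have h1 := h f hf hm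
    have h2 := h' f hf hm
    nlinarith

end holo

theorem artanh_eq_real {x : ℝ} (h1 : -1 ≤ x) (h2 : x ≤ 1) : artanh x = Real.artanh x :=
  (Real.artanh_eq_half_log ⟨h1, h2⟩).symm

theorem artanh_mono {x y : ℝ} (h1 : -1 < x) (h2 : y < 1) (h : x ≤ y) : artanh x ≤ artanh y := by
  rw [artanh_eq_real h1.le (by linarith), artanh_eq_real (by linarith) h2.le]
  exact Real.artanh_le_artanh h1 h2 h

theorem le_cara {D : Set (Cn n)} (hD : IsOpen D) (hc : IsPreconnected D) {z w : Cn n}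
    (hz : z ∈ D) (hw : w ∈ D) {f : Cn n → ℂ} (hf : DifferentiableOn ℂ f D)
    (hm : MapsTo f D (ball 0 1)) (h0 : f z = 0) : artanh ‖f w‖ ≤ cara D z w := by
  obtain ⟨c, hc0, hcb⟩ := cara_finite hD hc hz hw
  apply le_csSup
  · refine ⟨artanh (1 - c), ?_⟩
    rintro _ ⟨g, hg, hgm, hgz, rfl⟩
    have h1 := hcb g hg hgm
    rw [hgz] at h1
    simp only [norm_zero, sub_zero, mul_one] at h1
    apply artanh_mono _ _ _
    · linarith [norm_nonneg (g w)]
    · linarith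
    · linarith
  · exact ⟨f, hf, hm, h0, rfl⟩

theorem fridman_bdd (d : Cn n → Cn n → ℝ) (D : Set (Cn n)) (z : Cn n) :
    BddAbove (insert (0 : ℝ) {x : ℝ | ∃ r : ℝ, 0 ≤ r ∧ x = Real.tanh r ∧
    ∃ g : Cn n → Cn n, DifferentiableOn ℂ g (ball 0 1) ∧ InjOn g (ball 0 1) ∧
      MapsTo g (ball 0 1) D ∧ {w ∈ D | d z w < r} ⊆ g '' ball 0 1}) := by
  refine ⟨1, ?_⟩
  rintro x (rfl | ⟨r, -, rfl, -⟩)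
  · exact zero_le_one
  · exact (Real.tanh_lt_one r).le

theorem fridman_nonneg (d : Cn n → Cn n → ℝ) (D : Set (Cn n)) (z : Cn n) :
    0 ≤ fridman d D z :=
  le_csSup (fridman_bdd d D z) (mem_insert _ _)

theorem le_fridman {D : Set (Cn n)} (hD : IsOpen D) (hc : IsPreconnected D) {z : Cn n}
    (hz : z ∈ D) {f : Cn n → Cn n} (hf : DifferentiableOn ℂ f D) (hinj : InjOn f D)
    (hm : MapsTo f D (ball 0 1)) (h0 : f z = 0) {r : ℝ} (hr0 : 0 < r) (hr1 : r < 1)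
    (hr : ball (0 : Cn n) r ⊆ f '' D) : r ≤ fridman (cara D) D z := by
  apply le_csSup (fridman_bdd _ _ _)
  right
  have hrn : ((r : ℝ) : ℂ) ≠ 0 := by exact_mod_cast hr0.ne'
  have hball : ∀ w ∈ ball (0 : Cn n) 1, (r : ℂ) • w ∈ f '' D := by
    intro w hw
    apply hr
    rw [mem_ball_zero_iff] at hw ⊢
    rw [norm_smul, Complex.norm_real, Real.norm_of_nonneg hr0.le]
    nlinarith
  refine ⟨artanh r, ?_, ?_, fun w => Function.invFunOn f D ((r : ℂ) • w), ?_, ?_, ?_, ?_⟩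
  · have := artanh_mono (x := 0) (by norm_num) hr1 hr0.le
    simpa [artanh] using this
  · rw [artanh_eq_real (by linarith) hr1.le, Real.tanh_artanh ⟨by linarith, hr1⟩]
  · intro w hw
    obtain ⟨x, hx, hxw⟩ := hball w hw
    have h1 := inverse_holo hD hf hinj hx
    rw [hxw] at h1
    apply DifferentiableAt.differentiableWithinAt
    exact h1.comp (f := fun w : Cn n => (r : ℂ) • w) w (by fun_prop)
  · intro w hw w' hw' h
    have h1 := Function.invFunOn_eq (hball w hw)
    have h2 := Function.invFunOn_eq (hball w' hw')
    simp only at h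
    rw [h, h2] at h1
    exact (smul_right_injective _ hrn h1).symm
  · intro w hw
    exact Function.invFunOn_mem (hball w hw)
  · rintro w ⟨hw, hlt⟩
    have hfw1 : ‖f w‖ < 1 := by simpa using hm hw
    have hfw : ‖f w‖ < r := by
      by_contra hge
      push Not at hge
      have hne : ‖f w‖ ≠ 0 := by linarith
      obtain ⟨g, hg1, hgw⟩ := exists_dual_vector ℂ (f w) hne
      have h1 := le_cara hD hc hz hw (f := fun x => g (f x))
        (g.differentiable.comp_differentiableOn hf) (by
          intro x hx
          rw [mem_ball_zero_iff]
          have h2 : ‖f x‖ < 1 := by simpa using hm hx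
          refine (g.le_opNorm _).trans_lt ?_
          rw [hg1, one_mul]; exact h2) (by simp [h0])
      rw [hgw] at h1
      simp only [Complex.coe_algebraMap, RCLike.ofReal_eq_complex_ofReal, norm_norm, Complex.norm_real] at h1
      have h3 := artanh_mono (by linarith) hfw1 hge
      linarith
    refine ⟨(r : ℂ)⁻¹ • f w, ?_, ?_⟩
    · rw [mem_ball_zero_iff, norm_smul, norm_inv, Complex.norm_real, Real.norm_of_nonneg hr0.le,
        inv_mul_lt_iff₀ hr0]
      linarith
    · simp only [smul_inv_smul₀ hrn]
      exact hinj.leftInvOn_invFunOn hw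

/-- for any domain `D ⊆ ℂⁿ` and `z ∈ D`, the squeezing function is
dominated by the Fridman invariant with respect to the Carathéodory
pseudodistance: `s_D(z) ≤ h^c_D(z)`. -/
theorem squeeze_le_fridman_cara {n : ℕ} (D : Set (Cn n)) (hD : IsOpen D)
    (hDconn : IsConnected D) (z : Cn n) (hz : z ∈ D) :
    squeeze D z ≤ fridman (cara D) D z := by
  unfold squeeze
  rcases Nat.eq_zero_or_pos n with rfl | hn
  · refine le_trans ?_ (fridman_nonneg _ _ _)
    by_cases hb : BddAbove (insert (0 : ℝ) {r : ℝ | 0 < r ∧ ∃ f : Cn 0 → Cn 0,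
      DifferentiableOn ℂ f D ∧ InjOn f D ∧ MapsTo f D (ball 0 1) ∧ f z = 0 ∧
        ball (0 : Cn 0) r ⊆ f '' D})
    · obtain ⟨M, hM⟩ := hb
      apply csSup_le (insert_nonempty _ _)
      rintro r (rfl | ⟨hr, f, h1, h2, h3, h4, h5⟩)
      · exact le_rfl
      · exfalso
        have h6 := @hM (|M| + 1) (Or.inr ⟨by positivity, f, h1, h2, h3, h4, fun x _ => by
          rw [Subsingleton.elim x 0]; exact h5 (mem_ball_self hr)⟩)
        linarith [le_abs_self M]
    · rw [Real.sSup_of_not_bddAbove hb]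
  · apply csSup_le (insert_nonempty _ _)
    rintro r (rfl | ⟨hr, f, h1, h2, h3, h4, h5⟩)
    · exact fridman_nonneg _ _ _
    · have hr1 : r ≤ 1 := by
        by_contra hlt
        push Not at hlt
        let u : Cn n := EuclideanSpace.single ⟨0, hn⟩ (1 : ℂ)
        have hu : ‖u‖ = 1 := by simp [u]
        obtain ⟨x, hx, hxu⟩ := h5 (show u ∈ ball (0 : Cn n) r by
          rw [mem_ball_zero_iff, hu]; exact hlt)
        have := h3 hx
        rw [hxu, mem_ball_zero_iff, hu] at this
        exact lt_irrefl _ this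
      apply le_of_forall_lt_imp_le_of_dense
      intro s hs
      rcases le_or_gt s 0 with h | h
      · exact h.trans (fridman_nonneg _ _ _)
      · exact le_fridman hD hDconn.isPreconnected hz h1 h2 h3 h4 h (hs.trans_le hr1)
          ((ball_subset_ball hs.le).trans h5)

end
end

section
/- Localization of the squeezing function from below: let D ⊆ ℂⁿ be a domain, U an open set, V ⊆ U open, and t ∈ (0,1). Assume that for all z ∈ D ∩ V and w ∈ D \ U one has l_D(z,w) ≥ tanh⁻¹ t (where l_D is the Lempert function). Then for every z ∈ D ∩ V, s_{D∩U}(z) ≥ t · s_D(z). -/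
open Set Metric

noncomputable section

variable {n : ℕ}

lemma aux_maxN {Ω : Set ℂ} (hb : Bornology.IsBounded Ω) {ψ F : ℂ → ℂ}
    (hψ : DiffContOnCl ℂ ψ Ω) (hF : DiffContOnCl ℂ F Ω) {c : ℝ} (hc : 0 < c)
    (hfr : ∀ z ∈ frontier Ω, ψ z = 0 ∨ ‖F z‖ ≤ c) {z : ℂ} (hz : z ∈ Ω) (hz0 : ψ z ≠ 0) :
    ‖F z‖ ≤ c := by
  by_contra! hlt
  have hK : IsCompact (closure Ω) := hb.isCompact_closure
  obtain ⟨M, hM⟩ := hK.exists_bound_of_continuousOn hψ.continuousOn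
  have hM0 : 0 ≤ M := (norm_nonneg _).trans (hM z (subset_closure hz))
  have key : ∀ N : ℕ, ‖F z‖ ^ N * ‖ψ z‖ ≤ c ^ N * M := by
    intro N
    have hd : DiffContOnCl ℂ (fun w => F w ^ N * ψ w) Ω :=
      ⟨(hF.1.pow N).mul hψ.1, (hF.2.pow N).mul hψ.2⟩
    have := Complex.norm_le_of_forall_mem_frontier_norm_le hb hd (C := c ^ N * M) (fun w hw => by
      rcases hfr w hw with h | h
      · simp only [h, mul_zero, norm_zero]; positivity
      · rw [norm_mul, norm_pow]
        have := hM w (frontier_subset_closure hw)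
        gcongr) (subset_closure hz)
    simpa [norm_mul, norm_pow] using this
  have h1 : 1 < ‖F z‖ / c := by rwa [one_lt_div hc]
  obtain ⟨N, hN⟩ := pow_unbounded_of_one_lt (M / ‖ψ z‖) h1
  have hp : 0 < ‖ψ z‖ := norm_pos_iff.2 hz0
  have hcN : 0 < c ^ N := by positivity
  rw [div_pow, div_lt_div_iff₀ hp hcN] at hN
  have := key N
  nlinarith

lemma aux_open {W : Set ℂ} (hW : IsOpen W) {ψ : ℂ → ℂ} (hc : ContinuousOn ψ W) :
    IsOpen {z | z ∈ W ∧ ψ z ≠ 0} :=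
  hc.isOpen_inter_preimage hW isOpen_ne

/-- the nonvanishing set is dense. -/
lemma aux_dense {W : Set ℂ} (hW : IsOpen W) (hWc : IsPreconnected W) {ψ : ℂ → ℂ}
    (hc : ContinuousOn ψ W) (hd : ∀ z ∈ W, ψ z ≠ 0 → DifferentiableAt ℂ ψ z)
    (hne : ∃ z ∈ W, ψ z ≠ 0) : W ⊆ closure {z | z ∈ W ∧ ψ z ≠ 0} := by
  set Ω := {z | z ∈ W ∧ ψ z ≠ 0} with hΩ
  have hΩo : IsOpen Ω := aux_open hW hc
  -- the set interior (closure Ω) is clopen in W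
  have hsub : W ⊆ interior (closure Ω) := by
    apply hWc.subset_of_closure_inter_subset isOpen_interior
    · obtain ⟨z, hz, h⟩ := hne
      exact ⟨z, hz, interior_maximal subset_closure hΩo ⟨hz, h⟩⟩
    · rintro b ⟨hb, hbW⟩
      have hb' : b ∈ closure Ω := closure_minimal interior_subset isClosed_closure hb
      by_contra hbi
      obtain ⟨R, hR, hRW⟩ := Metric.nhds_basis_closedBall.mem_iff.1 (hW.mem_nhds hbW)
      have : ∃ a ∈ ball b (R / 4), a ∉ closure Ω := by
        by_contra! h
        exact hbi (mem_interior_iff_mem_nhds.2 (Filter.mem_of_superset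
          (ball_mem_nhds b (by positivity)) h))
      obtain ⟨a, ha, haΩ⟩ := this
      obtain ⟨z, hzΩ, hzb⟩ := Metric.mem_closure_iff.1 hb' (R / 4) (by positivity)
      rw [mem_ball] at ha
      rw [dist_comm] at hzb
      set O := Ω ∩ ball b R
      have hOb : Bornology.IsBounded O := isBounded_ball.subset inter_subset_right
      have hOo : IsOpen O := hΩo.inter isOpen_ball
      have hOcl : closure O ⊆ closedBall b R :=
        (closure_mono inter_subset_right).trans closure_ball_subset_closedBall
      have hOΩ : closure O ⊆ closure Ω := closure_mono inter_subset_left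
      have hψO : DiffContOnCl ℂ ψ O := ⟨fun x hx =>
        (hd x hx.1.1 hx.1.2).differentiableWithinAt, hc.mono (hOcl.trans hRW)⟩
      have hne' : ∀ x ∈ closure O, x - a ≠ 0 := fun x hx h => haΩ (by
        rw [sub_eq_zero] at h; exact h ▸ hOΩ hx)
      have hFO : DiffContOnCl ℂ (fun x => (x - a)⁻¹) O :=
        ⟨fun x hx => ((differentiableAt_id.sub_const a).inv
          (hne' x (subset_closure hx))).differentiableWithinAt,
          (continuousOn_id.sub continuousOn_const).inv₀ hne'⟩
      have hzO : z ∈ O := ⟨hzΩ, by rw [mem_ball]; linarith⟩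
      have := aux_maxN hOb hψO hFO (c := (3 * R / 4)⁻¹) (by positivity) (fun x hx => by
        have hxc := hOcl (frontier_subset_closure hx)
        by_cases h0 : ψ x = 0
        · exact Or.inl h0
        · right
          have hxR : ¬ dist x b < R := fun h => by
            rw [hOo.frontier_eq] at hx
            exact hx.2 ⟨⟨hRW hxc, h0⟩, h⟩
          rw [norm_inv]
          apply inv_anti₀ (by positivity)
          rw [← dist_eq_norm]
          have := dist_triangle x a b
          linarith) hzO hzΩ.2
      rw [norm_inv, inv_le_inv₀ (norm_pos_iff.2 (hne' z (subset_closure hzO))) (by positivity),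
        ← dist_eq_norm] at this
      have h3 := dist_triangle z b a
      rw [dist_comm b a] at h3
      linarith
  exact hsub.trans interior_subset

/-- trigonometric approximation -/
lemma aux_trig (u : ℂ → ℝ) (hu : ContinuousOn u (sphere 0 1)) {ε : ℝ} (hε : 0 < ε) :
    ∃ p : ℂ → ℂ, Differentiable ℂ p ∧ ∀ z ∈ sphere (0:ℂ) 1, |(p z).re - u z| ≤ ε := by
  have : Fact ((0:ℝ) < 1) := ⟨one_pos⟩
  let U : C(AddCircle (1:ℝ), ℂ) := ⟨fun x => (u (AddCircle.toCircle x : ℂ) : ℂ), by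
    apply Complex.continuous_ofReal.comp
    apply hu.comp_continuous (continuous_subtype_val.comp AddCircle.continuous_toCircle)
    intro x
    exact mem_sphere_zero_iff_norm.2 (Circle.norm_coe _)⟩
  have hmem : U ∈ (Submodule.span ℂ (range (@fourier (1:ℝ)))).topologicalClosure := by
    rw [span_fourier_closure_eq_top]; trivial
  rw [← SetLike.mem_coe, Submodule.topologicalClosure_coe, Metric.mem_closure_iff] at hmem
  obtain ⟨q, hq, hqU⟩ := hmem ε hε
  have hstr : ∃ p₁ p₂ : Polynomial ℂ, ∀ x : AddCircle (1:ℝ),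
      q x = p₁.eval (AddCircle.toCircle x : ℂ) + star (p₂.eval (AddCircle.toCircle x : ℂ)) := by
    rw [SetLike.mem_coe] at hq
    clear hqU
    induction hq using Submodule.span_induction with
    | mem x hx =>
      obtain ⟨k, rfl⟩ := hx
      obtain ⟨m, rfl | rfl⟩ := k.eq_nat_or_neg
      · refine ⟨Polynomial.X ^ m, 0, fun x => ?_⟩
        simp [fourier_apply, AddCircle.toCircle_nsmul]
      · refine ⟨0, Polynomial.X ^ m, fun x => ?_⟩
        simp only [fourier_apply, neg_smul, natCast_zsmul, AddCircle.toCircle_neg, AddCircle.toCircle_nsmul, Circle.coe_inv_eq_conj]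
        simp
    | zero => exact ⟨0, 0, by simp⟩
    | add a b _ _ ha hb =>
      obtain ⟨a1, a2, ha⟩ := ha
      obtain ⟨b1, b2, hb⟩ := hb
      refine ⟨a1 + b1, a2 + b2, fun x => ?_⟩
      simp only [ContinuousMap.add_apply, ha, hb, Polynomial.eval_add, star_add]; ring
    | smul c a _ ha =>
      obtain ⟨a1, a2, ha⟩ := ha
      refine ⟨Polynomial.C c * a1, Polynomial.C (star c) * a2, fun x => ?_⟩
      simp [ha, mul_add]
  obtain ⟨p₁, p₂, h⟩ := hstr
  refine ⟨fun z => p₁.eval z + p₂.eval z, p₁.differentiable.add p₂.differentiable, fun z hz => ?_⟩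
  obtain ⟨x, hx⟩ : ∃ x : AddCircle (1:ℝ), (AddCircle.toCircle x : ℂ) = z := by
    obtain ⟨x, hx⟩ := (AddCircle.homeomorphCircle (one_ne_zero : (1:ℝ) ≠ 0)).surjective
      ⟨z, by simpa [Submonoid.unitSphere] using hz⟩
    refine ⟨x, ?_⟩
    rw [AddCircle.homeomorphCircle_apply] at hx
    rw [hx]
  have h1 := (ContinuousMap.dist_apply_le_dist (f := U) (g := q) x).trans hqU.le
  rw [dist_comm, dist_eq_norm] at h1
  have h2 := (Complex.abs_re_le_norm _).trans h1
  rw [h] at h2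
  simpa [U, hx] using h2

lemma aux_re_const {F : ℂ → ℂ} {z : ℂ} (hF : ∀ᶠ w in nhds z, DifferentiableAt ℂ F w)
    (h0 : ∀ᶠ w in nhds z, (F w).re = 0) : ∀ᶠ w in nhds z, F w = F z := by
  have han : AnalyticAt ℂ F z := Complex.analyticAt_iff_eventually_differentiableAt.2 hF
  rcases han.eventually_constant_or_nhds_le_map_nhds with h | h
  · exact h
  · exfalso
    have h1 : ∀ᶠ w in nhds (F z), w.re = 0 := h h0
    obtain ⟨r, hr, hb⟩ := Metric.eventually_nhds_iff.1 h1
    have h2 := @hb (F z + (r/2 : ℝ)) (by simp [abs_of_pos hr]; linarith)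
    have h3 := h0.self_of_nhds
    simp [h3] at h2
    linarith

/-- on the nonvanishing set, the real part is a Poisson integral -/
lemma aux_poisson {ψ G : ℂ → ℂ} (hψ : ContinuousOn ψ (closedBall 0 1))
    (hG : ContinuousOn G (closedBall 0 1))
    (hdψ : ∀ z ∈ ball (0:ℂ) 1, ψ z ≠ 0 → DifferentiableAt ℂ ψ z)
    (hdG : ∀ z ∈ ball (0:ℂ) 1, ψ z ≠ 0 → DifferentiableAt ℂ G z) :
    ∃ V : ℂ → ℂ, DifferentiableOn ℂ V (ball 0 1) ∧
      ∀ z ∈ ball (0:ℂ) 1, ψ z ≠ 0 → (V z).re = (G z).re := by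
  have hGs : ContinuousOn (fun z => (G z).re) (sphere 0 1) :=
    Complex.continuous_re.comp_continuousOn (hG.mono sphere_subset_closedBall)
  have hcirI : CircleIntegrable (fun z => (G z).re) 0 1 :=
    hGs.circleIntegrable zero_le_one
  have hcirI' : CircleIntegrable (fun z => ((G z).re : ℂ)) 0 1 :=
    (Complex.continuous_ofReal.comp_continuousOn hGs).circleIntegrable zero_le_one
  refine ⟨fun w => Real.circleAverage (fun ζ ↦ herglotzRieszKernel 0 w ζ • ((G ζ).re : ℂ)) 0 1,
    differentiableOn_circleAverage_herglotzRieszKernel_smul hcirI', fun z hz hz0 => ?_⟩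
  rw [re_circleAverage_herglotzRieszKernel_smul hcirI hz]
  have hcont : ContinuousOn (Complex.re ∘ herglotzRieszKernel 0 z) (sphere 0 1) :=
    Complex.continuous_re.comp_continuousOn (by
      have := continuousOn_herglotzRieszKernel_sphere hz
      rwa [abs_one] at this)
  have hpos : ∀ w ∈ sphere (0:ℂ) 1, 0 ≤ (Complex.re ∘ herglotzRieszKernel 0 z) w := by
    intro w hw
    rw [← poissonKernel_eq_re_herglotzRieszKernel, poissonKernel_def]
    rw [mem_sphere_zero_iff_norm] at hw
    rw [mem_ball_zero_iff] at hz
    rw [sub_zero, sub_zero, hw]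
    apply div_nonneg _ (sq_nonneg _)
    nlinarith [norm_nonneg z]
  have hone : Real.circleAverage (Complex.re ∘ herglotzRieszKernel 0 z) 0 1 = 1 := by
    have := (diffContOnCl_const (c := (1:ℂ)) (s := ball (0:ℂ) 1) (𝕜 := ℂ)).circleAverage_re_herglotzRieszKernel_smul hz
    have h2 := congrArg Complex.reCLM this
    rw [← Complex.reCLM.circleAverage_comp_comm] at h2
    · simpa [Function.comp_def] using h2
    · apply ContinuousOn.circleIntegrable zero_le_one
      exact hcont.smul continuousOn_const
  refine eq_of_abs_sub_le_all (fun ε hε => ?_)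
  obtain ⟨p, hp, hpu⟩ := aux_trig _ hGs (half_pos hε)
  -- comparison on Ω
  set Ω := {z | z ∈ ball (0:ℂ) 1 ∧ ψ z ≠ 0}
  have hΩo : IsOpen Ω := aux_open isOpen_ball (hψ.mono ball_subset_closedBall)
  have hΩb : Bornology.IsBounded Ω := isBounded_ball.subset fun x hx => hx.1
  have hΩc : closure Ω ⊆ closedBall 0 1 :=
    (closure_mono fun x hx => hx.1).trans closure_ball_subset_closedBall
  have hdcψ : DiffContOnCl ℂ ψ Ω :=
    ⟨fun x hx => (hdψ x hx.1 hx.2).differentiableWithinAt, hψ.mono hΩc⟩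
  have hdcG : DiffContOnCl ℂ G Ω :=
    ⟨fun x hx => (hdG x hx.1 hx.2).differentiableWithinAt, hG.mono hΩc⟩
  have hdcp : DiffContOnCl ℂ p Ω := hp.diffContOnCl
  have hfront : ∀ x ∈ frontier Ω, ψ x = 0 ∨ x ∈ sphere (0:ℂ) 1 := by
    intro x hx
    by_cases h0 : ψ x = 0
    · exact Or.inl h0
    · right
      have h1 := hΩc (frontier_subset_closure hx)
      rw [hΩo.frontier_eq] at hx
      have h2 : x ∉ ball (0:ℂ) 1 := fun h => hx.2 ⟨h, h0⟩
      simp only [mem_closedBall, mem_ball, mem_sphere] at *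
      linarith
  have hexp : ∀ A : ℂ → ℂ, DiffContOnCl ℂ A Ω → (∀ x ∈ sphere (0:ℂ) 1, (A x).re ≤ ε / 2) →
      (A z).re ≤ ε / 2 := by
    intro A hA hAs
    have hE : DiffContOnCl ℂ (fun x => Complex.exp (A x)) Ω :=
      ⟨hA.1.cexp, hA.2.cexp⟩
    have := aux_maxN hΩb hdcψ hE (c := Real.exp (ε / 2)) (by positivity) (fun x hx => by
      rcases hfront x hx with h | h
      · exact Or.inl h
      · right; rw [Complex.norm_exp]; exact Real.exp_le_exp.2 (hAs x h)) (z := z) ⟨hz, hz0⟩ hz0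
    rw [Complex.norm_exp] at this
    exact Real.exp_le_exp.1 this
  have e1 := hexp (p - G) (hdcp.sub hdcG) (fun x hx => by
    have := abs_le.1 (hpu x hx); simp; linarith)
  have e2 := hexp (G - p) (hdcG.sub hdcp) (fun x hx => by
    have := abs_le.1 (hpu x hx); simp; linarith)
  simp only [Pi.sub_apply, Complex.sub_re] at e1 e2
  -- comparison of Poisson integrals
  have hpP : Real.circleAverage ((Complex.re ∘ herglotzRieszKernel 0 z) • fun x => (p x).re) 0 1
      = (p z).re := by
    have := (hp.diffContOnCl (s := ball (0:ℂ) 1)).circleAverage_re_herglotzRieszKernel_smul hz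
    have h2 := congrArg Complex.reCLM this
    rw [← Complex.reCLM.circleAverage_comp_comm] at h2
    · rw [Complex.reCLM_apply] at h2
      rw [← h2]
      congr 1
      ext x
      simp
    · apply ContinuousOn.circleIntegrable zero_le_one
      exact hcont.smul hp.continuous.continuousOn
  have hci : ∀ v : ℂ → ℝ, ContinuousOn v (sphere 0 1) →
      CircleIntegrable ((Complex.re ∘ herglotzRieszKernel 0 z) • v) 0 1 := fun v hv =>
    (hcont.smul hv).circleIntegrable zero_le_one
  have hpc : ContinuousOn (fun x => (p x).re) (sphere 0 1) :=
    (Complex.continuous_re.comp hp.continuous).continuousOn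
  have hcomp : ∀ v w : ℂ → ℝ, ContinuousOn v (sphere 0 1) → ContinuousOn w (sphere 0 1) →
      (∀ x ∈ sphere (0:ℂ) 1, v x ≤ w x + ε / 2) →
      Real.circleAverage ((Complex.re ∘ herglotzRieszKernel 0 z) • v) 0 1 ≤
      Real.circleAverage ((Complex.re ∘ herglotzRieszKernel 0 z) • w) 0 1 + ε / 2 := by
    intro v w hv hw hvw
    have hcs : CircleIntegrable ((ε / 2) • (Complex.re ∘ herglotzRieszKernel 0 z)) 0 1 :=
      ContinuousOn.circleIntegrable zero_le_one (hcont.const_smul (ε / 2))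
    have h1 : Real.circleAverage ((Complex.re ∘ herglotzRieszKernel 0 z) • v) 0 1 ≤
      Real.circleAverage ((Complex.re ∘ herglotzRieszKernel 0 z) • w +
        (ε / 2) • (Complex.re ∘ herglotzRieszKernel 0 z)) 0 1 := by
      apply Real.circleAverage_mono (hci v hv) ((hci w hw).add hcs)
      intro x hx
      rw [abs_one] at hx
      have a := hpos x hx
      have b := hvw x hx
      change (Complex.re ∘ herglotzRieszKernel 0 z) x * v x ≤
        (Complex.re ∘ herglotzRieszKernel 0 z) x * w x +
          (ε / 2) * (Complex.re ∘ herglotzRieszKernel 0 z) x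
      nlinarith
    rw [Real.circleAverage_add (hci w hw) hcs,
        Real.circleAverage_smul, hone] at h1
    simpa using h1
  have f1 := hcomp _ _ hGs hpc (fun x hx => by have := abs_le.1 (hpu x hx); linarith)
  have f2 := hcomp _ _ hpc hGs (fun x hx => by have := abs_le.1 (hpu x hx); linarith)
  rw [hpP] at f1 f2
  rw [abs_le]
  constructor <;> linarith

/-- Generalized Rado theorem. -/
lemma aux_rado {ψ G : ℂ → ℂ} (hψ : ContinuousOn ψ (closedBall 0 1))
    (hG : ContinuousOn G (closedBall 0 1))
    (hdψ : ∀ z ∈ ball (0:ℂ) 1, ψ z ≠ 0 → DifferentiableAt ℂ ψ z)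
    (hdG : ∀ z ∈ ball (0:ℂ) 1, ψ z ≠ 0 → DifferentiableAt ℂ G z)
    (hne : ∃ z ∈ ball (0:ℂ) 1, ψ z ≠ 0) : DifferentiableOn ℂ G (ball 0 1) := by
  obtain ⟨V, hV, hVG⟩ := aux_poisson hψ hG hdψ hdG
  obtain ⟨W, hW, hWG⟩ := aux_poisson (G := fun z => Complex.I * G z) hψ
    (continuousOn_const.mul hG) hdψ (fun z hz h0 => (hdG z hz h0).const_mul _)
  set Ω := {z | z ∈ ball (0:ℂ) 1 ∧ ψ z ≠ 0} with hΩ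
  have hψb := hψ.mono ball_subset_closedBall
  have hΩo : IsOpen Ω := aux_open isOpen_ball hψb
  have hdense := aux_dense isOpen_ball (convex_ball (0:ℂ) 1).isPreconnected hψb hdψ hne
  obtain ⟨z₀, hz₀, hz₀'⟩ := hne
  have hev : ∀ᶠ w in nhds z₀, w ∈ Ω := hΩo.mem_nhds ⟨hz₀, hz₀'⟩
  have hdV : ∀ w ∈ Ω, DifferentiableAt ℂ V w := fun w hw =>
    hV.differentiableAt (isOpen_ball.mem_nhds hw.1)
  have hdW : ∀ w ∈ Ω, DifferentiableAt ℂ W w := fun w hw =>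
    hW.differentiableAt (isOpen_ball.mem_nhds hw.1)
  have c1 := aux_re_const (F := fun w => V w - G w) (z := z₀)
    (hev.mono fun w hw => (hdV w hw).sub (hdG w hw.1 hw.2))
    (hev.mono fun w hw => by simp [hVG w hw.1 hw.2])
  have c2 := aux_re_const (F := fun w => W w - Complex.I * G w) (z := z₀)
    (hev.mono fun w hw => (hdW w hw).sub ((hdG w hw.1 hw.2).const_mul _))
    (hev.mono fun w hw => by rw [Complex.sub_re, hWG w hw.1 hw.2]; simp)
  have hWV : DifferentiableOn ℂ (fun w => W w - Complex.I * V w) (ball 0 1) :=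
    hW.sub (hV.const_mul _)
  have hconst : EqOn (fun w => W w - Complex.I * V w) (fun _ => W z₀ - Complex.I * V z₀) (ball 0 1) := by
    refine AnalyticOnNhd.eqOn_of_preconnected_of_eventuallyEq (hWV.analyticOnNhd isOpen_ball)
      analyticOnNhd_const (convex_ball (0:ℂ) 1).isPreconnected hz₀ ?_
    filter_upwards [c1, c2] with w h1 h2
    linear_combination h2 - Complex.I * h1
  set c := W z₀ - Complex.I * V z₀
  have hEq : ∀ z ∈ Ω, G z = V z - Complex.I * (c.re : ℂ) := by
    intro z hz
    have h1 := hVG z hz.1 hz.2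
    have h2 := hWG z hz.1 hz.2
    have h3 := congrArg Complex.re (hconst hz.1)
    simp at h2 h3
    apply Complex.ext
    · simp [h1]
    · simp; linarith
  have hEq' : EqOn G (fun z => V z - Complex.I * (c.re : ℂ)) (ball 0 1) := by
    refine EqOn.of_subset_closure (s := Ω) (t := ball 0 1) hEq (hG.mono ball_subset_closedBall)
      (hV.continuousOn.sub continuousOn_const) (fun x hx => hx.1) hdense
  exact (hV.sub_const _).congr hEq'


section multi
variable {E : Type*} [NormedAddCommGroup E] [NormedSpace ℂ E] [FiniteDimensional ℂ E]

lemma aux_fderiv_apply {F : Type*} [NormedAddCommGroup F] [NormedSpace ℂ F] [FiniteDimensional ℂ F]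
    {f : E → F} {D : Set E} (hD : IsOpen D)
    (hf : DifferentiableOn ℂ f D) (v : E) {x₀ : E} (hx₀ : x₀ ∈ D) :
    DifferentiableAt ℂ (fun x => fderiv ℂ f x v) x₀ := by
  have : ProperSpace E := FiniteDimensional.proper ℂ E
  have : CompleteSpace F := FiniteDimensional.complete ℂ F
  obtain ⟨R', hR', hRD'⟩ := Metric.nhds_basis_closedBall.mem_iff.1 (hD.mem_nhds hx₀)
  obtain ⟨R, hR, hRR⟩ : ∃ R > 0, 3 * R = R' := ⟨R' / 3, by positivity, by ring⟩
  have hRD : closedBall x₀ (3 * R) ⊆ D := hRR ▸ hRD'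
  obtain ⟨M, hM⟩ := (isCompact_closedBall x₀ (3 * R)).exists_bound_of_continuousOn
    (hf.continuousOn.mono hRD)
  have hbound : ∀ x ∈ closedBall x₀ (2 * R), ‖fderiv ℂ f x‖ ≤ (2 * M) / R := by
    intro x hx
    rw [mem_closedBall] at hx
    have hsub : ball x R ⊆ closedBall x₀ (3 * R) := fun y hy => by
      rw [mem_ball] at hy
      rw [mem_closedBall]
      linarith [dist_triangle y x x₀]
    refine Complex.norm_fderiv_le_div_of_mapsTo_ball (hf.mono (hsub.trans hRD)) (fun y hy => ?_) hR
    rw [mem_closedBall, dist_eq_norm]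
    have h1 := hM y (hsub hy)
    have h2 := hM x (hsub (mem_ball_self hR))
    linarith [norm_sub_le (f y) (f x)]
  obtain ⟨ρ, hρ, hρv⟩ : ∃ ρ > 0, ρ * ‖v‖ ≤ R := by
    refine ⟨R / (‖v‖ + 1), by positivity, ?_⟩
    rw [div_mul_eq_mul_div, div_le_iff₀ (by positivity)]
    nlinarith [norm_nonneg v]
  have hin : ∀ x ∈ ball x₀ R, ∀ ζ : ℂ, ‖ζ‖ ≤ ρ → x + ζ • v ∈ closedBall x₀ (2 * R) := by
    intro x hx ζ hζ
    rw [mem_ball, dist_eq_norm] at hx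
    rw [mem_closedBall, dist_eq_norm]
    have h1 : ‖ζ • v‖ ≤ R := by
      rw [norm_smul]; exact (by gcongr : ‖ζ‖ * ‖v‖ ≤ ρ * ‖v‖).trans hρv
    calc ‖x + ζ • v - x₀‖ = ‖(x - x₀) + ζ • v‖ := by congr 1; abel
      _ ≤ _ := (norm_add_le _ _).trans (by linarith)
  have hinD : ∀ x ∈ ball x₀ R, ∀ ζ : ℂ, ‖ζ‖ ≤ ρ → x + ζ • v ∈ D := fun x hx ζ hζ =>
    hRD (closedBall_subset_closedBall (by linarith) (hin x hx ζ hζ))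
  let κ : ℝ → ℂ := fun θ => (2 * Real.pi * Complex.I : ℂ)⁻¹ *
    (deriv (circleMap 0 ρ) θ * ((circleMap 0 ρ θ - 0) ^ 2)⁻¹)
  have hκ : Continuous κ := by
    have : ∀ θ, (circleMap 0 ρ θ - 0) ^ 2 ≠ 0 := fun θ => by
      simp [hρ.ne']
    simp only [κ, deriv_circleMap]
    refine continuous_const.mul (((continuous_circleMap 0 ρ).mul continuous_const).mul ?_)
    exact (((continuous_circleMap 0 ρ).sub continuous_const).pow 2).inv₀ this
  have hformula : ∀ x ∈ ball x₀ R, fderiv ℂ f x v =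
      ∫ θ in Ioc 0 (2 * Real.pi), κ θ • f (x + circleMap 0 ρ θ • v) := by
    intro x hx
    have hO : IsOpen ((fun ζ : ℂ => x + ζ • v) ⁻¹' D) := hD.preimage (by fun_prop)
    have hdiff : DifferentiableOn ℂ (fun ζ : ℂ => f (x + ζ • v)) ((fun ζ : ℂ => x + ζ • v) ⁻¹' D) :=
      hf.comp (by fun_prop) (fun _ h => h)
    have h := Complex.two_pi_I_inv_smul_circleIntegral_sub_sq_inv_smul_of_differentiable hO
      (c := 0) (R := ρ) (w₀ := 0) (fun ζ hζ => hinD x hx ζ (by simpa using hζ)) hdiff (mem_ball_self hρ)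
    have hxD : x ∈ D := by simpa using hinD x hx 0 (by simpa using hρ.le)
    have hder : HasDerivAt (fun ζ : ℂ => f (x + ζ • v)) (fderiv ℂ f x v) 0 := by
      have h1 : HasFDerivAt f (fderiv ℂ f x) (x + (0:ℂ) • v) := by
        simpa using (hf.differentiableAt (hD.mem_nhds hxD)).hasFDerivAt
      have h2 : HasDerivAt (fun ζ : ℂ => x + ζ • v) v 0 := by
        simpa using ((hasDerivAt_id (0:ℂ)).smul_const v).const_add x
      exact h1.comp_hasDerivAt (0:ℂ) h2
    rw [hder.deriv] at h
    rw [← h, circleIntegral, intervalIntegral.integral_of_le Real.two_pi_pos.le, ← MeasureTheory.integral_smul]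
    congr 1
    ext θ
    simp only [κ, smul_smul, mul_assoc]
  have hev : (fun x => fderiv ℂ f x v) =ᶠ[nhds x₀]
      fun x => ∫ θ in Ioc 0 (2 * Real.pi), κ θ • f (x + circleMap 0 ρ θ • v) := by
    filter_upwards [ball_mem_nhds x₀ hR] with x hx using hformula x hx
  refine DifferentiableAt.congr_of_eventuallyEq ?_ hev
  have hcirc : ∀ θ, ‖circleMap 0 ρ θ‖ ≤ ρ := fun θ => by simp [abs_of_pos hρ]
  have hcont : ∀ x ∈ ball x₀ R, Continuous fun θ => κ θ • f (x + circleMap 0 ρ θ • v) := by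
    intro x hx
    refine hκ.smul (hf.continuousOn.comp_continuous ?_ (fun θ => hinD x hx _ (hcirc θ)))
    have := continuous_circleMap 0 ρ
    fun_prop
  obtain ⟨K, hK⟩ := isCompact_Icc.exists_bound_of_continuousOn
    (s := Icc 0 (2 * Real.pi)) hκ.continuousOn
  borelize E
  borelize (E →L[ℂ] F)
  have hmeasf : Measurable fun θ => fderiv ℂ f (x₀ + circleMap 0 ρ θ • v) := by
    refine (measurable_fderiv ℂ f).comp (Continuous.measurable ?_)
    have := continuous_circleMap 0 ρ
    fun_prop
  refine (hasFDerivAt_integral_of_dominated_of_fderiv_le (𝕜 := ℂ)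
    (F' := fun x θ => κ θ • fderiv ℂ f (x + circleMap 0 ρ θ • v))
    (bound := fun _ => K * ((2 * M) / R)) (s := ball x₀ R)
    (ball_mem_nhds x₀ hR) ?_ ?_ ?_ ?_ ?_ ?_).differentiableAt
  · filter_upwards [ball_mem_nhds x₀ hR] with x hx using (hcont x hx).aestronglyMeasurable
  · exact ((hcont x₀ (mem_ball_self hR)).integrableOn_Ioc)
  · exact (hκ.measurable.smul hmeasf).aestronglyMeasurable
  · refine (MeasureTheory.ae_restrict_iff' measurableSet_Ioc).2 (Filter.Eventually.of_forall ?_)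
    intro θ hθ x hx
    rw [norm_smul]
    have a := hK θ (Ioc_subset_Icc_self hθ)
    have b := hbound _ (hin x hx _ (hcirc θ))
    exact mul_le_mul a b (norm_nonneg _) ((norm_nonneg _).trans a)
  · exact continuous_const.integrableOn_Ioc
  · refine Filter.Eventually.of_forall fun θ x hx => ?_
    have h1 := (hf.differentiableAt (hD.mem_nhds (hinD x hx _ (hcirc θ)))).hasFDerivAt
    exact ((hasFDerivAt_comp_add_right (circleMap 0 ρ θ • v)).2 h1).const_smul (κ θ)

lemma aux_fderiv {F : Type*} [NormedAddCommGroup F] [NormedSpace ℂ F] [FiniteDimensional ℂ F]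
    {f : E → F} {D : Set E} (hD : IsOpen D)
    (hf : DifferentiableOn ℂ f D) {x₀ : E} (hx₀ : x₀ ∈ D) :
    DifferentiableAt ℂ (fderiv ℂ f) x₀ := by
  let b := Module.finBasis ℂ E
  let c : Fin (Module.finrank ℂ E) → (E →L[ℂ] ℂ) := fun i => LinearMap.toContinuousLinearMap (b.coord i)
  have : fderiv ℂ f = fun x => ∑ i, ContinuousLinearMap.smulRightL ℂ E F (c i) (fderiv ℂ f x (b i)) := by
    ext x v
    have h1 : fderiv ℂ f x v = ∑ i, (b.repr v) i • (fderiv ℂ f x) (b i) := by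
      conv_lhs => rw [← b.sum_repr v]
      rw [map_sum]
      exact Finset.sum_congr rfl fun i _ => by rw [map_smul]
    rw [h1]
    simp [c]
  rw [this]
  exact DifferentiableAt.fun_sum fun i _ =>
    (ContinuousLinearMap.differentiableAt _).comp x₀ (aux_fderiv_apply hD hf (b i) hx₀)

lemma aux_strict {F : Type*} [NormedAddCommGroup F] [NormedSpace ℂ F] [FiniteDimensional ℂ F]
    {f : E → F} {D : Set E} (hD : IsOpen D)
    (hf : DifferentiableOn ℂ f D) {x₀ : E} (hx₀ : x₀ ∈ D) :
    HasStrictFDerivAt f (fderiv ℂ f x₀) x₀ :=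
  hasStrictFDerivAt_of_hasFDerivAt_of_continuousAt
    (by filter_upwards [hD.mem_nhds hx₀] with y hy using
      (hf.differentiableAt (hD.mem_nhds hy)).hasFDerivAt)
    (aux_fderiv hD hf hx₀).continuousAt

lemma aux_det_diff {G : Type*} [NormedAddCommGroup G] [NormedSpace ℂ G]
    {A : G → (E →L[ℂ] E)} {x : G} (hA : DifferentiableAt ℂ A x) :
    DifferentiableAt ℂ (fun y => (A y).det) x := by
  let b := Module.finBasis ℂ E
  have : (fun y => (A y).det) = fun y => (LinearMap.toMatrix b b (A y : E →ₗ[ℂ] E)).det := by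
    ext y
    rw [LinearMap.det_toMatrix]
  rw [this]
  simp only [Matrix.det_apply]
  refine DifferentiableAt.fun_sum fun σ _ => DifferentiableAt.const_smul ?_ _
  refine (HasFDerivAt.finsetProd fun i _ => DifferentiableAt.hasFDerivAt ?_).differentiableAt
  let L : (E →L[ℂ] E) →ₗ[ℂ] ℂ :=
    { toFun := fun B => LinearMap.toMatrix b b (B : E →ₗ[ℂ] E) (σ i) i
      map_add' := by intro B C; simp
      map_smul' := by intro c B; simp }
  have : DifferentiableAt ℂ (fun y => (LinearMap.toContinuousLinearMap L) (A y)) x :=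
    (LinearMap.toContinuousLinearMap L).differentiableAt.comp x hA
  exact this

/-- identity theorem: a holomorphic function on a connected open set vanishing near a point. -/
lemma aux_identity {D : Set E} (hD : IsOpen D) (hDc : IsPreconnected D) {h : E → ℂ}
    (hh : DifferentiableOn ℂ h D) {p : E} (hp : p ∈ D) (hp0 : h =ᶠ[nhds p] 0) :
    ∀ x ∈ D, h x = 0 := by
  have hsub : D ⊆ {x | h =ᶠ[nhds x] 0} := by
    apply hDc.subset_of_closure_inter_subset isOpen_setOfPred_eventually_nhds
    · exact ⟨p, hp, hp0⟩
    · rintro x ⟨hx, hxD⟩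
      obtain ⟨R, hR, hRD⟩ := Metric.mem_nhds_iff.1 (hD.mem_nhds hxD)
      obtain ⟨y, hy, hxy⟩ := Metric.mem_closure_iff.1 hx R hR
      have hyb : y ∈ ball x R := by rwa [mem_ball, dist_comm]
      filter_upwards [ball_mem_nhds x hR] with w hw
      let L : ℂ → E := fun ζ => y + ζ • (w - y)
      have hLd : Differentiable ℂ L := by fun_prop
      have hLo : IsOpen (L ⁻¹' ball x R) := isOpen_ball.preimage hLd.continuous
      have hLc : Convex ℝ (L ⁻¹' ball x R) := by
        intro a ha b hb s t hs ht hst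
        have : L (s • a + t • b) = s • L a + t • L b := by
          simp only [L]
          have hy' : y = s • y + t • y := by rw [← add_smul, hst, one_smul]
          nth_rewrite 1 [hy']
          simp only [smul_add, add_smul, smul_assoc]
          abel
        rw [mem_preimage, this]
        exact convex_ball x R ha hb hs ht hst
      have han : AnalyticOnNhd ℂ (fun ζ => h (L ζ)) (L ⁻¹' ball x R) :=
        DifferentiableOn.analyticOnNhd
          ((hh.mono hRD).comp hLd.differentiableOn (fun _ h => h)) hLo
      have h0 : L 0 = y := by simp [L]
      have h1 : L 1 = w := by simp [L]
      have hev : (fun ζ => h (L ζ)) =ᶠ[nhds 0] 0 := by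
        have : Filter.Tendsto L (nhds 0) (nhds y) := by
          simpa [h0] using hLd.continuous.tendsto 0
        exact this.eventually hy
      have := han.eqOn_zero_of_preconnected_of_eventuallyEq_zero hLc.isPreconnected
        (z₀ := 0) (by rw [mem_preimage, h0]; exact hyb) hev
        (show (1:ℂ) ∈ _ by rw [mem_preimage, h1]; exact hw)
      simpa [h1] using this
  intro x hx
  exact (hsub hx).self_of_nhds

end multi

section multi2
variable {E : Type*} [NormedAddCommGroup E] [NormedSpace ℂ E] [FiniteDimensional ℂ E]

lemma aux_sard {f : E → E} {D : Set E} (hD : IsOpen D) (hf : DifferentiableOn ℂ f D)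
    {r : ℝ} (hr : 0 < r) (hball : ball (0 : E) r ⊆ f '' D) :
    ∃ x ∈ D, (fderiv ℂ f x).det ≠ 0 := by
  by_contra! hcon
  have : FiniteDimensional ℝ E := FiniteDimensional.complexToReal E
  borelize E
  have h0 : (MeasureTheory.Measure.addHaar : MeasureTheory.Measure E) (f '' D) = 0 := by
    refine MeasureTheory.addHaar_image_eq_zero_of_det_fderivWithin_eq_zero _
      (f' := fun x => (fderiv ℂ f x).restrictScalars ℝ) (fun x hx => ?_) (fun x hx => ?_)
    · exact ((hf.differentiableAt (hD.mem_nhds hx)).hasFDerivAt.restrictScalars ℝ).hasFDerivWithinAt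
    · have h1 := LinearMap.bot_lt_ker_of_det_eq_zero (f := (fderiv ℂ f x : E →ₗ[ℂ] E)) (hcon x hx)
      obtain ⟨v, hv, hv0⟩ := Submodule.exists_mem_ne_zero_of_ne_bot h1.ne'
      by_contra hne
      have h2 := (((fderiv ℂ f x).restrictScalars ℝ : E →ₗ[ℝ] E).equivOfDetNeZero hne).injective
      apply hv0
      apply h2
      rw [map_zero]
      exact hv
  have h1 := MeasureTheory.measure_mono_null hball h0
  exact (measure_ball_pos (MeasureTheory.Measure.addHaar : MeasureTheory.Measure E) 0 hr).ne' h1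

lemma aux_image_nhds {f : E → E} {D : Set E} (hD : IsOpen D) (hf : DifferentiableOn ℂ f D)
    {p : E} (hp : p ∈ D) (hJ : (fderiv ℂ f p).det ≠ 0) {W : Set E} (hW : W ∈ nhds p) :
    f '' W ∈ nhds (f p) := by
  have : CompleteSpace E := FiniteDimensional.complete ℂ E
  have h := aux_strict hD hf hp
  rw [← ContinuousLinearMap.coe_toContinuousLinearEquivOfDetNeZero _ hJ] at h
  rw [← h.map_nhds_eq_of_equiv]
  exact Filter.image_mem_map hW

lemma aux_J {f : E → E} {D : Set E} (hD : IsOpen D) (hf : DifferentiableOn ℂ f D) :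
    DifferentiableOn ℂ (fun x => (fderiv ℂ f x).det) D := fun _ hx =>
  (aux_det_diff (aux_fderiv hD hf hx)).differentiableWithinAt

lemma aux_inv {f g : E → E} {D : Set E} (hD : IsOpen D) (hf : DifferentiableOn ℂ f D)
    {y : E} (hp : g y ∈ D) (hJ : (fderiv ℂ f (g y)).det ≠ 0) (hg : ContinuousAt g y)
    (hfg : ∀ᶠ z in nhds y, f (g z) = z) : DifferentiableAt ℂ g y := by
  have h := (aux_strict hD hf hp).hasFDerivAt
  rw [← ContinuousLinearMap.coe_toContinuousLinearEquivOfDetNeZero _ hJ] at h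
  exact (HasFDerivAt.of_local_left_inverse hg h hfg).differentiableAt

lemma aux_jdense {f : E → E} {D : Set E} (hD : IsOpen D) (hDc : IsPreconnected D)
    (hf : DifferentiableOn ℂ f D) (hne : ∃ x ∈ D, (fderiv ℂ f x).det ≠ 0)
    {x : E} (hx : x ∈ D) {W : Set E} (hW : W ∈ nhds x) :
    ∃ p ∈ W, p ∈ D ∧ (fderiv ℂ f p).det ≠ 0 := by
  by_contra! hcon
  obtain ⟨q, hq, hq0⟩ := hne
  refine hq0 (aux_identity hD hDc (aux_J hD hf) hx ?_ q hq)
  filter_upwards [hW, hD.mem_nhds hx] with p hp hpD using hcon p hp hpD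

lemma aux_convex_line (a v c : E) (R : ℝ) :
    Convex ℝ ((fun ζ : ℂ => a + ζ • v) ⁻¹' ball c R) := by
  intro x hx y hy s t hs ht hst
  have : a + (s • x + t • y) • v = s • (a + x • v) + t • (a + y • v) := by
    have hy' : a = s • a + t • a := by rw [← add_smul, hst, one_smul]
    nth_rewrite 1 [hy']
    simp only [smul_add, add_smul, smul_assoc]
    abel
  rw [mem_preimage, this]
  exact convex_ball c R hx hy hs ht hst

lemma aux_open_map {f : E → E} {D : Set E} (hD : IsOpen D) (hf : DifferentiableOn ℂ f D)
    (hinj : InjOn f D)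
    (hdense : ∀ x ∈ D, ∀ W ∈ nhds x, ∃ p ∈ W, p ∈ D ∧ (fderiv ℂ f p).det ≠ 0)
    {x : E} (hx : x ∈ D) {W₀ : Set E} (hW₀ : W₀ ∈ nhds x) : f '' (W₀ ∩ D) ∈ nhds (f x) := by
  classical
  have : ProperSpace E := FiniteDimensional.proper ℂ E
  obtain ⟨R, hR, hRsub⟩ := Metric.nhds_basis_closedBall.mem_iff.1
    (Filter.inter_mem hW₀ (hD.mem_nhds hx))
  set K := closedBall x R with hK
  have hKD : K ⊆ D := fun y hy => (hRsub hy).2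
  have hKc : IsCompact K := isCompact_closedBall x R
  have hfc := hf.continuousOn
  have hSc : IsClosed (f '' sphere x R) :=
    ((isCompact_sphere x R).image_of_continuousOn
      (hfc.mono (sphere_subset_closedBall.trans hKD))).isClosed
  have hxS : f x ∉ f '' sphere x R := by
    rintro ⟨y, hy, hyx⟩
    have := hinj (hKD (sphere_subset_closedBall hy)) hx hyx
    rw [this] at hy
    simp at hy
    exact hR.ne hy
  obtain ⟨δ, hδ, hB⟩ := Metric.mem_nhds_iff.1 (hSc.isOpen_compl.mem_nhds hxS)
  have hfKc : IsCompact (f '' K) := hKc.image_of_continuousOn (hfc.mono hKD)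
  set g := Function.invFunOn f K with hg
  have hgK : ∀ y ∈ f '' K, g y ∈ K := fun y hy => Function.invFunOn_mem hy
  have hfg : ∀ y ∈ f '' K, f (g y) = y := fun y hy => Function.invFunOn_eq hy
  have hgf : ∀ p ∈ K, g (f p) = p := fun p hp =>
    hinj (hKD (hgK _ ⟨p, hp, rfl⟩)) (hKD hp) (hfg _ ⟨p, hp, rfl⟩)
  have hgc : ContinuousOn g (f '' K) := by
    rw [continuousOn_iff_isClosed]
    intro t ht
    refine ⟨f '' (K ∩ t), ((hKc.inter_right ht).image_of_continuousOn
      (hfc.mono (inter_subset_left.trans hKD))).isClosed, ?_⟩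
    ext y
    constructor
    · rintro ⟨hy, hyK⟩
      exact ⟨⟨g y, ⟨hgK y hyK, hy⟩, hfg y hyK⟩, hyK⟩
    · rintro ⟨⟨p, ⟨hp, hpt⟩, rfl⟩, hyK⟩
      refine ⟨?_, hyK⟩
      rw [mem_preimage, hgf p hp]
      exact hpt
  set J : E → ℂ := fun x => (fderiv ℂ f x).det with hJ
  have hJd : DifferentiableOn ℂ J D := aux_J hD hf
  set h : E → ℂ := fun y => if y ∈ f '' K then J (g y) else 0 with hh
  have hJgc : ContinuousOn (fun y => J (g y)) (f '' K) :=
    hJd.continuousOn.comp hgc fun y hy => hKD (hgK y hy)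
  have hdiff : ∀ y ∈ ball (f x) δ, h y ≠ 0 → DifferentiableAt ℂ h y := by
    intro y hy hne
    have hyK : y ∈ f '' K := by
      by_contra hn
      exact hne (by simp only [hh, if_neg hn])
    have hJne : J (g y) ≠ 0 := by simpa only [hh, if_pos hyK] using hne
    have hgb : g y ∈ ball x R := by
      have h1 := hgK y hyK
      rw [hK, ← ball_union_sphere] at h1
      rcases h1 with h1 | h1
      · exact h1
      · exact absurd ⟨g y, h1, hfg y hyK⟩ (hB hy)
    have hnh : f '' K ∈ nhds y := by
      have := aux_image_nhds hD hf (hKD (hgK y hyK)) hJne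
        (Filter.mem_of_superset (isOpen_ball.mem_nhds hgb) ball_subset_closedBall)
      rwa [hfg y hyK] at this
    have hgd : DifferentiableAt ℂ g y := aux_inv hD hf (hKD (hgK y hyK)) hJne
      (hgc.continuousAt hnh) (by filter_upwards [hnh] with z hz using hfg z hz)
    have hJgd : DifferentiableAt ℂ (fun z => J (g z)) y :=
      (hJd.differentiableAt (hD.mem_nhds (hKD (hgK y hyK)))).comp y hgd
    refine hJgd.congr_of_eventuallyEq ?_
    filter_upwards [hnh] with z hz
    simp only [hh, if_pos hz]
  have hcont : ∀ y ∈ ball (f x) δ, ContinuousAt h y := by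
    intro y hy
    by_cases hne : h y = 0
    · rw [ContinuousAt, hne]
      by_cases hyK : y ∈ f '' K
      · have h0 : J (g y) = 0 := by simpa only [hh, if_pos hyK] using hne
        have h1 := hJgc y hyK
        rw [ContinuousWithinAt, h0, Metric.tendsto_nhds] at h1
        rw [Metric.tendsto_nhds]
        intro ε hε
        filter_upwards [eventually_nhdsWithin_iff.1 (h1 ε hε)] with z hz
        by_cases hzK : z ∈ f '' K
        · simpa only [hh, if_pos hzK] using hz hzK
        · simpa only [hh, if_neg hzK, dist_self] using hε
      · refine tendsto_nhds_of_eventually_eq ?_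
        filter_upwards [hfKc.isClosed.isOpen_compl.mem_nhds hyK] with z hz
        simp only [hh, if_neg hz]
    · exact (hdiff y hy hne).continuousAt
  have hBK : ball (f x) δ ⊆ f '' K := by
    intro a₀ ha₀
    by_contra hn
    obtain ⟨p, ⟨hpB, hpK⟩, hpD, hpJ⟩ := hdense x hx (f ⁻¹' ball (f x) δ ∩ K)
      (Filter.inter_mem ((hf.differentiableAt (hD.mem_nhds hx)).continuousAt.preimage_mem_nhds
        (ball_mem_nhds _ hδ)) (closedBall_mem_nhds x hR))
    set y₁ := f p with hy₁
    have hhy₁ : h y₁ ≠ 0 := by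
      have : y₁ ∈ f '' K := ⟨p, hpK, rfl⟩
      simp only [hh, if_pos this]
      rw [hgf p hpK]
      exact hpJ
    let L : ℂ → E := fun ζ => y₁ + ζ • (a₀ - y₁)
    have hLd : Differentiable ℂ L := by fun_prop
    have h0 : L 0 = y₁ := by simp [L]
    have h1 : L 1 = a₀ := by simp [L]
    have hWo : IsOpen (L ⁻¹' ball (f x) δ) := isOpen_ball.preimage hLd.continuous
    have hWc : Convex ℝ (L ⁻¹' ball (f x) δ) := aux_convex_line _ _ _ _
    have hden := aux_dense (ψ := fun ζ => h (L ζ)) hWo hWc.isPreconnected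
      (fun ζ hζ => ((hcont (L ζ) hζ).comp hLd.continuous.continuousAt).continuousWithinAt)
      (fun ζ hζ hne => (hdiff (L ζ) hζ hne).comp ζ hLd.differentiableAt)
      ⟨0, by rw [mem_preimage, h0]; exact hpB, by simpa only [h0] using hhy₁⟩
    have h1m : (1:ℂ) ∈ L ⁻¹' ball (f x) δ := by rw [mem_preimage, h1]; exact ha₀
    have hO : IsOpen (L ⁻¹' (f '' K)ᶜ) := hfKc.isClosed.isOpen_compl.preimage hLd.continuous
    obtain ⟨ζ, hζ1, hζ2, hζ3⟩ := mem_closure_iff.1 (hden h1m) _ hO (by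
      rw [mem_preimage, h1]; exact hn)
    apply hζ3
    have : L ζ ∉ f '' K := hζ1
    simp only [hh, if_neg this]
  refine Filter.mem_of_superset (ball_mem_nhds _ hδ) (hBK.trans (image_mono hRsub))

lemma aux_disc {f : E → E} {D : Set E} (hD : IsOpen D) (hDc : IsPreconnected D)
    (hf : DifferentiableOn ℂ f D) (hinj : InjOn f D) {r : ℝ} (hr : 0 < r)
    (hball : ball (0 : E) r ⊆ f '' D) (u : E) (hu : ‖u‖ ≤ 1) :
    DifferentiableOn ℂ (fun ζ : ℂ => Function.invFunOn f D (((r : ℂ) * ζ) • u)) (ball 0 1) := by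
  have : ProperSpace E := FiniteDimensional.proper ℂ E
  have hdense : ∀ x ∈ D, ∀ W ∈ nhds x, ∃ p ∈ W, p ∈ D ∧ (fderiv ℂ f p).det ≠ 0 :=
    fun x hx W hW => aux_jdense hD hDc hf (aux_sard hD hf hr hball) hx hW
  set g := Function.invFunOn f D with hg
  have hgD : ∀ y ∈ f '' D, g y ∈ D := fun y hy => Function.invFunOn_mem hy
  have hfg : ∀ y ∈ f '' D, f (g y) = y := fun y hy => Function.invFunOn_eq hy
  have hgf : ∀ p ∈ D, g (f p) = p := fun p hp =>
    hinj (hgD _ ⟨p, hp, rfl⟩) hp (hfg _ ⟨p, hp, rfl⟩)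
  have hgc : ∀ y ∈ ball (0:E) r, ContinuousAt g y := by
    intro y hy W hW
    have h1 := aux_open_map hD hf hinj hdense (hgD y (hball hy)) hW
    rw [hfg y (hball hy)] at h1
    refine Filter.mem_map.2 (Filter.mem_of_superset h1 ?_)
    rintro _ ⟨p, ⟨hpW, hpD⟩, rfl⟩
    rw [mem_preimage, hgf p hpD]
    exact hpW
  set J : E → ℂ := fun x => (fderiv ℂ f x).det with hJ
  have hJd : DifferentiableOn ℂ J D := aux_J hD hf
  have hgd : ∀ y ∈ ball (0:E) r, J (g y) ≠ 0 → DifferentiableAt ℂ g y := fun y hy hne =>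
    aux_inv hD hf (hgD y (hball hy)) hne (hgc y hy) (by
      filter_upwards [isOpen_ball.mem_nhds hy] with z hz using hfg z (hball hz))
  have hJat : ∀ y ∈ ball (0:E) r, DifferentiableAt ℂ J (g y) := fun y hy =>
    hJd.differentiableAt (hD.mem_nhds (hgD y (hball hy)))
  have h0r : (0:E) ∈ ball (0:E) r := mem_ball_self hr
  have hvk : ∀ ε > 0, ∃ v : E, ‖v‖ < ε ∧ v ∈ ball (0:E) r ∧ J (g v) ≠ 0 := by
    intro ε hε
    have hx := hgD 0 (hball h0r)
    have hN : f ⁻¹' (ball 0 ε ∩ ball 0 r) ∈ nhds (g 0) := by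
      refine (hf.differentiableAt (hD.mem_nhds hx)).continuousAt.preimage_mem_nhds ?_
      rw [hfg 0 (hball h0r)]
      exact Filter.inter_mem (ball_mem_nhds _ hε) (ball_mem_nhds _ hr)
    obtain ⟨p, ⟨hp1, hp2⟩, hpD, hpJ⟩ := hdense _ hx _ hN
    refine ⟨f p, by simpa using hp1, hp2, ?_⟩
    rw [hgf p hpD]
    exact hpJ
  -- coordinates
  let b := Module.finBasis ℂ E
  suffices H : ∀ ℓ : E →L[ℂ] ℂ, DifferentiableOn ℂ (fun ζ : ℂ => ℓ (g (((r : ℂ) * ζ) • u))) (ball 0 1) by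
    have : (fun ζ : ℂ => g (((r : ℂ) * ζ) • u)) = fun ζ : ℂ => ∑ i,
        (LinearMap.toContinuousLinearMap (b.coord i)) (g (((r : ℂ) * ζ) • u)) • b i := by
      ext ζ
      exact (b.sum_repr _).symm
    rw [this]
    exact DifferentiableOn.fun_sum fun i _ => (H _).smul_const _
  intro ℓ
  suffices H : ∀ ρ : ℝ, 0 < ρ → ρ < 1 →
      DifferentiableOn ℂ (fun ζ : ℂ => ℓ (g (((r * ρ : ℂ) * ζ) • u))) (ball 0 1) by
    intro ζ₀ hζ₀
    rw [mem_ball_zero_iff] at hζ₀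
    obtain ⟨ρ, hρ1, hρ2⟩ := exists_between hζ₀
    have hρ : 0 < ρ := (norm_nonneg _).trans_lt hρ1
    have hρc : (ρ : ℂ) ≠ 0 := by exact_mod_cast hρ.ne'
    have hm : ζ₀ / ρ ∈ ball (0:ℂ) 1 := by
      rw [mem_ball_zero_iff, norm_div, Complex.norm_real, Real.norm_of_nonneg hρ.le,
        div_lt_one hρ]
      exact hρ1
    have h1 := (H ρ hρ hρ2).differentiableAt (isOpen_ball.mem_nhds hm)
    have h2 : DifferentiableAt ℂ (fun ζ : ℂ => ζ / ρ) ζ₀ := by fun_prop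
    have h3 := h1.comp ζ₀ h2
    refine (h3.congr_of_eventuallyEq (Filter.Eventually.of_forall fun ζ => ?_)).differentiableWithinAt
    simp only [Function.comp]
    have : (r * ρ : ℂ) * (ζ / ρ) = r * ζ := by field_simp
    rw [this]
  intro ρ hρ hρ1
  set η := r * (1 - ρ) / 2 with hη
  have hηpos : 0 < η := by have : 0 < 1 - ρ := by linarith
                           positivity
  have hmem : ∀ ζ : ℂ, ‖ζ‖ ≤ 1 → ∀ v : E, ‖v‖ ≤ η →
      ((r * ρ : ℂ) * ζ) • u + v ∈ closedBall (0:E) (r * ρ + η) := by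
    intro ζ hζ v hv
    rw [mem_closedBall_zero_iff]
    refine (norm_add_le _ _).trans (add_le_add ?_ hv)
    rw [norm_smul, norm_mul, norm_mul, Complex.norm_real, Complex.norm_real,
      Real.norm_of_nonneg hr.le, Real.norm_of_nonneg hρ.le]
    calc r * ρ * ‖ζ‖ * ‖u‖ ≤ r * ρ * 1 * 1 := by gcongr
      _ = r * ρ := by ring
  have hlt : r * ρ + η < r := by rw [hη]; nlinarith
  have hcb : closedBall (0:E) (r * ρ + η) ⊆ ball 0 r := closedBall_subset_ball hlt
  choose v hv using fun k : ℕ => hvk (η / (k + 1)) (by positivity)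
  have hvη : ∀ k, ‖v k‖ ≤ η := fun k => (hv k).1.le.trans
    (div_le_self hηpos.le (by have : (0:ℝ) ≤ k := k.cast_nonneg
                              linarith))
  have hk : ∀ k, DifferentiableOn ℂ (fun ζ : ℂ => ℓ (g (((r * ρ : ℂ) * ζ) • u + v k))) (ball 0 1) := by
    intro k
    have hLd : Differentiable ℂ (fun ζ : ℂ => ((r * ρ : ℂ) * ζ) • u + v k) := by fun_prop
    have hin : ∀ ζ ∈ closedBall (0:ℂ) 1, ((r * ρ : ℂ) * ζ) • u + v k ∈ ball (0:E) r := fun ζ hζ =>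
      hcb (hmem ζ (by simpa using hζ) _ (hvη k))
    have hgcomp : ∀ ζ ∈ closedBall (0:ℂ) 1,
        ContinuousAt (fun ζ : ℂ => g (((r * ρ : ℂ) * ζ) • u + v k)) ζ := fun ζ hζ =>
      ContinuousAt.comp (f := fun ζ : ℂ => ((r * ρ : ℂ) * ζ) • u + v k) (hgc _ (hin ζ hζ))
        hLd.continuous.continuousAt
    have hgdcomp : ∀ ζ ∈ ball (0:ℂ) 1, J (g (((r * ρ : ℂ) * ζ) • u + v k)) ≠ 0 →
        DifferentiableAt ℂ (fun ζ : ℂ => g (((r * ρ : ℂ) * ζ) • u + v k)) ζ := fun ζ hζ hne =>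
      DifferentiableAt.comp (f := fun ζ : ℂ => ((r * ρ : ℂ) * ζ) • u + v k) ζ
        (hgd _ (hin ζ (ball_subset_closedBall hζ)) hne) hLd.differentiableAt
    refine aux_rado (ψ := fun ζ : ℂ => J (g (((r * ρ : ℂ) * ζ) • u + v k))) ?_ ?_ ?_ ?_ ?_
    · intro ζ hζ
      exact (ContinuousAt.comp (f := fun ζ : ℂ => g (((r * ρ : ℂ) * ζ) • u + v k))
        (hJat _ (hin ζ hζ)).continuousAt (hgcomp ζ hζ)).continuousWithinAt
    · intro ζ hζ
      exact (ContinuousAt.comp (f := fun ζ : ℂ => g (((r * ρ : ℂ) * ζ) • u + v k))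
        ℓ.continuous.continuousAt (hgcomp ζ hζ)).continuousWithinAt
    · intro ζ hζ hne
      exact DifferentiableAt.comp (f := fun ζ : ℂ => g (((r * ρ : ℂ) * ζ) • u + v k)) ζ
        (hJat _ (hin ζ (ball_subset_closedBall hζ))) (hgdcomp ζ hζ hne)
    · intro ζ hζ hne
      exact ℓ.differentiableAt.comp ζ (hgdcomp ζ hζ hne)
    · exact ⟨0, mem_ball_self one_pos, by simpa using (hv k).2.2⟩
  have hunif : UniformContinuousOn g (closedBall (0:E) (r * ρ + η)) :=
    (isCompact_closedBall _ _).uniformContinuousOn_of_continuous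
      fun y hy => (hgc y (hcb hy)).continuousWithinAt
  have hunif2 : UniformContinuousOn (fun y => ℓ (g y)) (closedBall (0:E) (r * ρ + η)) :=
    ℓ.uniformContinuous.comp_uniformContinuousOn hunif
  have htend : TendstoUniformlyOn (fun (k : ℕ) (ζ : ℂ) => ℓ (g (((r * ρ : ℂ) * ζ) • u + v k)))
      (fun ζ : ℂ => ℓ (g (((r * ρ : ℂ) * ζ) • u))) Filter.atTop (ball 0 1) := by
    rw [Metric.tendstoUniformlyOn_iff]
    intro ε hε
    obtain ⟨δ, hδ, hδ'⟩ := Metric.uniformContinuousOn_iff.1 hunif2 ε hε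
    have hv0 : Filter.Tendsto (fun k : ℕ => η / ((k:ℝ) + 1)) Filter.atTop (nhds 0) := by
      have := (tendsto_one_div_add_atTop_nhds_zero_nat (𝕜 := ℝ)).const_mul η
      simpa [mul_one_div, div_eq_mul_inv] using this
    filter_upwards [hv0.eventually (gt_mem_nhds hδ)] with k hkδ ζ hζ
    have hζ' : ‖ζ‖ ≤ 1 := by simpa using (mem_ball_zero_iff.1 hζ).le
    refine hδ' _ ?_ _ (hmem ζ hζ' _ (hvη k)) ?_
    · simpa using hmem ζ hζ' 0 (by simpa using hηpos.le)
    · rw [dist_self_add_right]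
      exact (hv k).1.trans hkδ
  exact htend.tendstoLocallyUniformlyOn.differentiableOn
    (Filter.Eventually.of_forall hk) isOpen_ball

end multi2

lemma aux_artanh_lt {a b : ℝ} (ha : 0 ≤ a) (hab : a < b) (hb : b < 1) : artanh a < artanh b := by
  unfold artanh
  have h1 : (1 + a) / (1 - a) < (1 + b) / (1 - b) := by
    rw [div_lt_div_iff₀ (by linarith) (by linarith)]
    nlinarith
  have h2 : 0 < (1 + a) / (1 - a) := div_pos (by linarith) (by linarith)
  have := Real.log_lt_log h2 h1
  linarith

lemma aux_artanh_zero : artanh 0 = 0 := by simp [artanh]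

lemma aux_squeeze_nonneg (D : Set (Cn n)) (z : Cn n) : 0 ≤ squeeze D z := by
  refine Real.sSup_nonneg ?_
  rintro x (rfl | ⟨hx, -⟩)
  · exact le_rfl
  · exact hx.le

lemma aux_bdd {n : ℕ} (hn : n ≠ 0) (D : Set (Cn n)) (z : Cn n) :
    BddAbove (insert (0 : ℝ) {r : ℝ | 0 < r ∧ ∃ f : Cn n → Cn n, DifferentiableOn ℂ f D ∧
    InjOn f D ∧ MapsTo f D (ball 0 1) ∧ f z = 0 ∧ ball (0 : Cn n) r ⊆ f '' D}) := by
  refine ⟨1, ?_⟩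
  rintro x (rfl | ⟨hx, f, -, -, hm, -, hb⟩)
  · exact zero_le_one
  · by_contra hlt
    push Not at hlt
    have i : Fin n := ⟨0, Nat.pos_of_ne_zero hn⟩
    have h1 : EuclideanSpace.single i (1:ℂ) ∈ ball (0 : Cn n) x := by
      simpa using hlt
    obtain ⟨p, hp, hpe⟩ := hb h1
    have := hm hp
    rw [hpe] at this
    simp at this

/-- the key inclusion: preimages of small vectors lie in `U`. -/
lemma aux_key {n : ℕ} (D U V : Set (Cn n)) (hD : IsOpen D)
    (hDconn : IsConnected D) (hVU : V ⊆ U)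
    (t : ℝ) (ht0 : 0 < t) (ht1 : t < 1)
    (hlem : ∀ z ∈ D ∩ V, ∀ w ∈ D \ U, ENNReal.ofReal (artanh t) ≤ lempert D z w)
    {z : Cn n} (hz : z ∈ D ∩ V) {r : ℝ} (hr : 0 < r) {f : Cn n → Cn n}
    (hf : DifferentiableOn ℂ f D) (hinj : InjOn f D) (hfz : f z = 0)
    (hball : ball (0 : Cn n) r ⊆ f '' D) {w : Cn n} (hw : w ∈ D) (hwt : ‖f w‖ < t * r) :
    w ∈ U := by
  by_contra hwU
  have hne : f w ≠ 0 := by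
    intro h0
    have : w = z := hinj hw hz.1 (h0.trans hfz.symm)
    exact hwU (hVU (this ▸ hz.2))
  have hpos : 0 < ‖f w‖ := norm_pos_iff.2 hne
  set u : Cn n := ((‖f w‖ : ℂ)⁻¹) • f w with hu
  have hnc : (‖f w‖ : ℂ) ≠ 0 := by exact_mod_cast hpos.ne'
  have hu1 : ‖u‖ = 1 := by
    rw [hu, norm_smul, norm_inv, Complex.norm_real, norm_norm, inv_mul_cancel₀ hpos.ne']
  have hgD : ∀ y ∈ f '' D, Function.invFunOn f D y ∈ D := fun y hy => Function.invFunOn_mem hy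
  have hgf : ∀ p ∈ D, Function.invFunOn f D (f p) = p := fun p hp =>
    hinj (hgD _ ⟨p, hp, rfl⟩) hp (Function.invFunOn_eq (b := f p) ⟨p, hp, rfl⟩)
  have hdiff := aux_disc hD hDconn.isPreconnected hf hinj hr hball u hu1.le
  set l : ℝ := ‖f w‖ / r with hl
  have hl0 : 0 ≤ l := by positivity
  have hlt : l < t := by rw [hl, div_lt_iff₀ hr]; exact hwt
  have hlem' := hlem z hz w ⟨hw, hwU⟩
  have hle : lempert D z w ≤ ENNReal.ofReal (artanh l) := by
    refine sInf_le ⟨_, hdiff, ?_, ?_, (l : ℂ), ?_, ?_, ?_⟩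
    · intro ζ hζ
      refine hgD _ (hball ?_)
      rw [mem_ball_zero_iff] at hζ ⊢
      rw [norm_smul, hu1, mul_one, norm_mul, Complex.norm_real, Real.norm_of_nonneg hr.le]
      nlinarith
    · simp only [mul_zero, zero_smul]
      rw [← hfz]
      exact hgf z hz.1
    · rw [mem_ball_zero_iff, Complex.norm_real, Real.norm_of_nonneg hl0]
      exact hlt.trans ht1
    · have : ((r : ℂ) * (l : ℂ)) • u = f w := by
        have hrc : (r : ℂ) ≠ 0 := by exact_mod_cast hr.ne'
        rw [hu, smul_smul, hl]
        push_cast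
        rw [mul_div_cancel₀ _ hrc, mul_inv_cancel₀ hnc, one_smul]
      rw [this]
      exact hgf w hw
    · rw [Complex.norm_real, Real.norm_of_nonneg hl0]
  have h1 : artanh l < artanh t := aux_artanh_lt hl0 hlt ht1
  have h2 : 0 < artanh t := by
    rw [← aux_artanh_zero]; exact aux_artanh_lt le_rfl ht0 ht1
  exact absurd (hlem'.trans hle) (not_le.2 ((ENNReal.ofReal_lt_ofReal_iff h2).2 h1))

/-- localization of the squeezing function from below: let
`D ⊆ ℂⁿ` be a domain, `U` open, `V ⊆ U` open, `t ∈ (0,1)`. If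
`l_D(z,w) ≥ tanh⁻¹ t` for all `z ∈ D ∩ V` and `w ∈ D \ U`, then
`s_{D∩U}(z) ≥ t · s_D(z)` for every `z ∈ D ∩ V`. -/
theorem squeeze_localization {n : ℕ} (D U V : Set (Cn n)) (hD : IsOpen D)
    (hDconn : IsConnected D) (hU : IsOpen U) (hV : IsOpen V) (hVU : V ⊆ U)
    (t : ℝ) (ht0 : 0 < t) (ht1 : t < 1)
    (hlem : ∀ z ∈ D ∩ V, ∀ w ∈ D \ U,
      ENNReal.ofReal (artanh t) ≤ lempert D z w) :
    ∀ z ∈ D ∩ V, t * squeeze D z ≤ squeeze (D ∩ U) z := by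
  intro z hz
  rcases Nat.eq_zero_or_pos n with rfl | hn
  · have : D ∩ U = D := by
      refine inter_eq_left.2 fun w _ => ?_
      rw [Subsingleton.elim w z]
      exact hVU hz.2
    rw [this]
    have := aux_squeeze_nonneg D z
    nlinarith
  · rw [mul_comm, ← le_div_iff₀ ht0]
    refine csSup_le (insert_nonempty _ _) ?_
    rintro r (rfl | ⟨hr, f, hf, hinj, hm, hfz, hball⟩)
    · exact div_nonneg (aux_squeeze_nonneg _ _) ht0.le
    · rw [le_div_iff₀ ht0]
      refine le_csSup (aux_bdd hn.ne' _ _) (Or.inr ⟨by positivity, f, hf.mono inter_subset_left,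
        hinj.mono inter_subset_left, fun x hx => hm hx.1, hfz, ?_⟩)
      intro y hy
      rw [mem_ball_zero_iff] at hy
      obtain ⟨w, hw, rfl⟩ := hball (show y ∈ ball (0 : Cn n) r by
        rw [mem_ball_zero_iff]; nlinarith)
      exact ⟨w, ⟨hw, aux_key D U V hD hDconn hVU t ht0 ht1 hlem hz hr hf hinj hfz hball hw
        (by linarith)⟩, rfl⟩

end
end
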